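/- A sequence (d_1, d_2, d_3) of three positive integers is the degree sequence of a hsop of I_5 (the ring of invariants of the binary quintic) if and only if: all d_i are even; no d_i lies in {2, 6, 10, 14}; the multiset {d_1, d_2, d_3} contains neither the sub-multiset {4, 4} nor the sub-multiset {4, 22}; at least two of the d_i are divisible by 4; at least one is divisible by 6; and at least one is divisible by 8. -/

import Mathlib

set_option synthInstance.maxHeartbeats 1000000
noncomputable section

open MvPolynomial

/-- The binary form of degree `n` with coefficient vector `a`, as a polynomial in two
variables `X 0 = x`, `X 1 = y`. -/
def formPoly (n : ℕ) (a : Fin (n+1) → ℂ) : MvPolynomial (Fin 2) ℂ :=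
  ∑ i : Fin (n+1), C (a i) * X 0 ^ (n - (i : ℕ)) * X 1 ^ (i : ℕ)

/-- The action of `SL(2,ℂ)` on coefficient vectors of binary forms of degree `n`,
given by linear substitution of the variables `x`, `y`. -/
def sl2Act (n : ℕ) (g : Matrix.SpecialLinearGroup (Fin 2) ℂ) (a : Fin (n+1) → ℂ) :
    Fin (n+1) → ℂ := fun i =>
  coeff (Finsupp.single 0 (n - (i : ℕ)) + Finsupp.single 1 (i : ℕ))
    (bind₁ (fun j : Fin 2 => C (g.1 j 0) * X 0 + C (g.1 j 1) * X 1) (formPoly n a))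

/-- The ring of invariants `I_n` of the binary form of degree `n`: the subalgebra of
`ℂ[a_0,…,a_n]` of polynomials invariant under the `SL(2,ℂ)`-action. -/
def invariantRing (n : ℕ) : Subalgebra ℂ (MvPolynomial (Fin (n+1)) ℂ) where
  carrier := {p | ∀ g : Matrix.SpecialLinearGroup (Fin 2) ℂ, ∀ a : Fin (n+1) → ℂ,
    eval (sl2Act n g a) p = eval a p}
  mul_mem' := by
    intro p q hp hq g a
    simp only [Set.mem_setOf_eq, map_mul] at *
    rw [hp g a, hq g a]
  add_mem' := by
    intro p q hp hq g a
    simp only [Set.mem_setOf_eq, map_add] at *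
    rw [hp g a, hq g a]
  algebraMap_mem' := by
    intro c g a
    simp

/-- `IsHSOP n d p` says that `p` is a homogeneous system of parameters of the invariant
ring of the binary form of degree `n`, with degree sequence `d` : the `p k` are
homogeneous of positive degrees `d k`, algebraically independent over `ℂ`, and `I_n` is a
finitely generated module over the subalgebra they generate. -/
def IsHSOP (n : ℕ) (d : Fin (n-2) → ℕ) (p : Fin (n-2) → invariantRing n) : Prop :=
  (∀ k, 0 < d k) ∧
  (∀ k, ((p k : MvPolynomial (Fin (n+1)) ℂ)).IsHomogeneous (d k)) ∧
  AlgebraicIndependent ℂ p ∧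
  Module.Finite (Algebra.adjoin ℂ (Set.range p)) (invariantRing n)

theorem coeff_formPoly (n : ℕ) (a : Fin (n+1) → ℂ) (i : Fin (n+1)) :
    coeff (Finsupp.single 0 (n - (i : ℕ)) + Finsupp.single 1 (i : ℕ)) (formPoly n a) = a i := by
  classical
  have key : ∀ k : Fin (n+1), (C (a k) * X 0 ^ (n - (k : ℕ)) * X 1 ^ (k : ℕ) :
      MvPolynomial (Fin 2) ℂ) =
      monomial (Finsupp.single 0 (n - (k : ℕ)) + Finsupp.single 1 (k : ℕ)) (a k) := by
    intro k
    rw [X_pow_eq_monomial, X_pow_eq_monomial, C_mul_monomial, monomial_mul]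
    simp
  unfold formPoly
  rw [coeff_sum, Finset.sum_eq_single i]
  · rw [key, coeff_monomial, if_pos rfl]
  · intro k _ hk
    rw [key, coeff_monomial, if_neg]
    intro h
    have := DFunLike.congr_fun h 1
    simp at this
    exact hk (Fin.ext this)
  · simp

theorem formPoly_isHomogeneous (n : ℕ) (a : Fin (n+1) → ℂ) : (formPoly n a).IsHomogeneous n := by
  refine IsHomogeneous.sum _ _ _ fun i _ => ?_
  have h := ((isHomogeneous_C (Fin 2) (a i)).mul ((isHomogeneous_X ℂ (0 : Fin 2)).pow
    (n - (i : ℕ)))).mul ((isHomogeneous_X ℂ (1 : Fin 2)).pow (i : ℕ))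
  convert h using 1
  have := i.2
  omega

theorem formPoly_of_isHomogeneous (n : ℕ) (p : MvPolynomial (Fin 2) ℂ) (hp : p.IsHomogeneous n) :
    formPoly n (fun i => coeff (Finsupp.single 0 (n - (i : ℕ)) + Finsupp.single 1 (i : ℕ)) p) =
      p := by
  ext m
  by_cases hm : m.degree = n
  · have hm' : m 0 + m 1 = n := by
      rw [← hm, Finsupp.degree_eq_sum, Fin.sum_univ_two]
    have : m = Finsupp.single 0 (n - m 1) + Finsupp.single 1 (m 1) := by
      ext j
      fin_cases j
      · simp
        omega
      · simp
    have h2 := coeff_formPoly n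
      (fun i => coeff (Finsupp.single 0 (n - (i : ℕ)) + Finsupp.single 1 (i : ℕ)) p)
      ⟨m 1, by omega⟩
    simp only at h2
    rw [← this] at h2
    exact h2
  · rw [(formPoly_isHomogeneous n _).coeff_eq_zero hm, hp.coeff_eq_zero hm]

theorem bind₁_isHomogeneous {σ τ : Type*} {n : ℕ} (p : MvPolynomial σ ℂ) (hp : p.IsHomogeneous n)
    (f : σ → MvPolynomial τ ℂ) (hf : ∀ j, (f j).IsHomogeneous 1) :
    (bind₁ f p).IsHomogeneous n := by
  have h := hp.aeval f hf
  rw [one_mul] at h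
  exact h

theorem isHomogeneous_linearForm (a b : ℂ) :
    (C a * X 0 + C b * X 1 : MvPolynomial (Fin 2) ℂ).IsHomogeneous 1 := by
  have h0 := (isHomogeneous_C (Fin 2) a).mul (isHomogeneous_X ℂ (0 : Fin 2))
  have h1 := (isHomogeneous_C (Fin 2) b).mul (isHomogeneous_X ℂ (1 : Fin 2))
  exact h0.add h1

/-- The linear substitution given by `g`, as an endomorphism of `ℂ[x, y]`. -/
def linearSubst (g : Matrix.SpecialLinearGroup (Fin 2) ℂ) :
    MvPolynomial (Fin 2) ℂ →ₐ[ℂ] MvPolynomial (Fin 2) ℂ :=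
  bind₁ (fun j : Fin 2 => C (g.1 j 0) * X 0 + C (g.1 j 1) * X 1)

theorem sl2Act_apply (n : ℕ) (g : Matrix.SpecialLinearGroup (Fin 2) ℂ) (a : Fin (n+1) → ℂ)
    (i : Fin (n+1)) : sl2Act n g a i =
      coeff (Finsupp.single 0 (n - (i : ℕ)) + Finsupp.single 1 (i : ℕ))
        (linearSubst g (formPoly n a)) := by
  have h : ∀ p : MvPolynomial (Fin 2) ℂ,
      bind₁ (fun j : Fin 2 => (C (g.1 j 0) * X 0 + C (g.1 j 1) * X 1 : MvPolynomial ℕ ℂ)) p =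
        rename (Fin.val : Fin 2 → ℕ) (linearSubst g p) := by
    intro p
    unfold linearSubst
    induction p using MvPolynomial.induction_on with
    | C r => simp
    | add p q hp hq => rw [map_add, map_add, map_add, hp, hq]
    | mul_X p i hp =>
      rw [map_mul, map_mul, map_mul, hp, bind₁_X_right, bind₁_X_right]
      simp
  rw [← coeff_rename_mapDomain (Fin.val : Fin 2 → ℕ) Fin.val_injective, ← h,
    Finsupp.mapDomain_add, Finsupp.mapDomain_single, Finsupp.mapDomain_single]
  rfl

theorem formPoly_sl2Act (n : ℕ) (g : Matrix.SpecialLinearGroup (Fin 2) ℂ) (a : Fin (n+1) → ℂ) :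
    formPoly n (sl2Act n g a) = linearSubst g (formPoly n a) := by
  have h := formPoly_of_isHomogeneous n (linearSubst g (formPoly n a))
    (bind₁_isHomogeneous _ (formPoly_isHomogeneous n a) _ fun j => isHomogeneous_linearForm _ _)
  rw [← h]
  congr 1
  funext i
  rw [sl2Act_apply]

/-- The value of the binary quintic with coefficient vector `a`. -/
def quinticVal (a : Fin (5+1) → ℂ) (x y : ℂ) : ℂ :=
  a 0 * x ^ 5 + a 1 * x ^ 4 * y + a 2 * x ^ 3 * y ^ 2 + a 3 * x ^ 2 * y ^ 3 + a 4 * x * y ^ 4 +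
    a 5 * y ^ 5

theorem eval_formPoly_five (a : Fin (5+1) → ℂ) (v : Fin 2 → ℂ) :
    eval v (formPoly 5 a) = quinticVal a (v 0) (v 1) := by
  simp [formPoly, quinticVal, Fin.sum_univ_succ]
  ring

theorem quinticVal_sl2Act (g : Matrix.SpecialLinearGroup (Fin 2) ℂ) (a : Fin (5+1) → ℂ)
    (x y : ℂ) : quinticVal (sl2Act 5 g a) x y =
      quinticVal a (g.1 0 0 * x + g.1 0 1 * y) (g.1 1 0 * x + g.1 1 1 * y) := by
  have h := congrArg (eval ![x, y]) (formPoly_sl2Act 5 g a)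
  rw [eval_formPoly_five] at h
  refine h.trans ?_
  have h2 : ∀ p : MvPolynomial (Fin 2) ℂ, eval ![x, y] (linearSubst g p) =
      eval ![g.1 0 0 * x + g.1 0 1 * y, g.1 1 0 * x + g.1 1 1 * y] p := by
    intro p
    unfold linearSubst
    induction p using MvPolynomial.induction_on with
    | C r => simp
    | add p q hp hq => rw [map_add, map_add, map_add, hp, hq]
    | mul_X p i hp =>
      rw [map_mul, map_mul, map_mul, hp, bind₁_X_right]
      fin_cases i <;> simp
  rw [h2, eval_formPoly_five]
  rfl

theorem quinticVal_injective {a b : Fin (5+1) → ℂ}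
    (h : ∀ x y, quinticVal a x y = quinticVal b x y) : a = b := by
  have : formPoly 5 a = formPoly 5 b := by
    refine MvPolynomial.funext fun v => ?_
    rw [eval_formPoly_five, eval_formPoly_five, h]
  funext i
  rw [← coeff_formPoly 5 a i, this, coeff_formPoly]

theorem sl_mul_apply (g h : Matrix.SpecialLinearGroup (Fin 2) ℂ) (i j : Fin 2) :
    (g * h).1 i j = g.1 i 0 * h.1 0 j + g.1 i 1 * h.1 1 j := by
  have : (g * h).1 = g.1 * h.1 := rfl
  rw [this, Matrix.mul_apply, Fin.sum_univ_two]

theorem sl2Act_mul (g h : Matrix.SpecialLinearGroup (Fin 2) ℂ) (a : Fin (5+1) → ℂ) :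
    sl2Act 5 (g * h) a = sl2Act 5 h (sl2Act 5 g a) := by
  refine quinticVal_injective fun x y => ?_
  simp only [quinticVal_sl2Act]
  simp only [sl_mul_apply]
  congr 1 <;> ring

/-- The substitution `x ↦ x + t y`, `y ↦ y`. -/
def upperUnipotent (t : ℂ) : Matrix.SpecialLinearGroup (Fin 2) ℂ :=
  ⟨!![1, t; 0, 1], by simp [Matrix.det_fin_two]⟩

/-- The substitution `x ↦ x`, `y ↦ t x + y`. -/
def lowerUnipotent (t : ℂ) : Matrix.SpecialLinearGroup (Fin 2) ℂ :=
  ⟨!![1, 0; t, 1], by simp [Matrix.det_fin_two]⟩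

theorem mem_invariantRing_of_unipotent (p : MvPolynomial (Fin (5+1)) ℂ)
    (hU : ∀ t a, eval (sl2Act 5 (upperUnipotent t) a) p = eval a p)
    (hL : ∀ t a, eval (sl2Act 5 (lowerUnipotent t) a) p = eval a p) : p ∈ invariantRing 5 := by
  have key : ∀ g : Matrix.SpecialLinearGroup (Fin 2) ℂ, g.1 1 0 ≠ 0 → ∀ a,
      eval (sl2Act 5 g a) p = eval a p := by
    intro g hg a
    have hdet := g.2
    rw [Matrix.det_fin_two] at hdet
    have : g = upperUnipotent ((g.1 0 0 - 1) / g.1 1 0) * lowerUnipotent (g.1 1 0) *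
        upperUnipotent ((g.1 1 1 - 1) / g.1 1 0) := by
      refine Subtype.ext (Matrix.ext fun i j => ?_)
      fin_cases i <;> fin_cases j <;> simp only [sl_mul_apply] <;>
        simp only [upperUnipotent, lowerUnipotent, Matrix.of_apply, Matrix.cons_val', Fin.zero_eta,
          Fin.mk_one, Matrix.cons_val_zero, Matrix.cons_val_one, Matrix.cons_val_fin_one] <;>
        field_simp
      · ring
      · linear_combination -hdet
      · ring
      · ring
    rw [this, sl2Act_mul, sl2Act_mul, hU, hL, hU]
  intro g a
  by_cases hg : g.1 1 0 = 0
  · have hdet := g.2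
    rw [Matrix.det_fin_two, hg] at hdet
    have h11 : g.1 1 1 ≠ 0 := by
      intro h
      simp [h] at hdet
    rw [← hL 1, ← sl2Act_mul]
    refine key _ ?_ a
    rw [sl_mul_apply]
    simp [lowerUnipotent, hg, h11]
  · exact key g hg a

section Covariants

variable {R : Type*} [CommRing R]

/-- The quadratic covariant of degree 2 of the quintic `∑ (5 choose i) b_i x^(5-i) y^i`. -/
def quadCov (b : Fin (5+1) → R) : Fin 3 → R :=
  ![b 0 * b 4 - 4 * b 1 * b 3 + 3 * b 2 ^ 2, b 0 * b 5 - 3 * b 1 * b 4 + 2 * b 2 * b 3,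
    b 1 * b 5 - 4 * b 2 * b 4 + 3 * b 3 ^ 2]

/-- The cubic covariant (canonizant) of degree 3 of the quintic: the maximal minors of its
catalecticant matrix. -/
def cubicCov (b : Fin (5+1) → R) : Fin 4 → R :=
  ![b 0 * (b 2 * b 4 - b 3 ^ 2) - b 1 * (b 1 * b 4 - b 2 * b 3) + b 2 * (b 1 * b 3 - b 2 ^ 2),
    b 0 * (b 2 * b 5 - b 3 * b 4) - b 1 * (b 1 * b 5 - b 2 * b 4) + b 3 * (b 1 * b 3 - b 2 ^ 2),
    b 0 * (b 3 * b 5 - b 4 ^ 2) - b 2 * (b 1 * b 5 - b 2 * b 4) + b 3 * (b 1 * b 4 - b 2 * b 3),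
    b 1 * (b 3 * b 5 - b 4 ^ 2) - b 2 * (b 2 * b 5 - b 3 * b 4) + b 3 * (b 2 * b 4 - b 3 ^ 2)]

/-- The Hessian of a binary cubic. -/
def hessianCov (j : Fin 4 → R) : Fin 3 → R :=
  ![j 1 ^ 2 - 3 * j 0 * j 2, j 1 * j 2 - 9 * j 0 * j 3, j 2 ^ 2 - 3 * j 1 * j 3]

/-- The linear covariant of a binary quadratic form and a binary cubic form. -/
def linCov (i : Fin 3 → R) (j : Fin 4 → R) : Fin 2 → R :=
  ![i 0 * j 2 - i 1 * j 1 + 3 * i 2 * j 0, 3 * i 0 * j 3 - i 1 * j 2 + i 2 * j 1]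

/-- The Jacobian of two binary quadratic forms. -/
def jacCov (i t : Fin 3 → R) : Fin 3 → R :=
  ![i 0 * t 1 - i 1 * t 0, 2 * (i 0 * t 2 - i 2 * t 0), i 1 * t 2 - i 2 * t 1]

def quadDisc (i : Fin 3 → R) : R := i 1 ^ 2 - 4 * i 0 * i 2

def quadPairing (i t : Fin 3 → R) : R := i 1 * t 1 - 2 * i 0 * t 2 - 2 * i 2 * t 0

def cubicDisc (j : Fin 4 → R) : R :=
  j 1 ^ 2 * j 2 ^ 2 - 4 * j 0 * j 2 ^ 3 - 4 * j 1 ^ 3 * j 3 + 18 * j 0 * j 1 * j 2 * j 3 -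
    27 * j 0 ^ 2 * j 3 ^ 2

def quadAtRoot (h : Fin 3 → R) (l : Fin 2 → R) : R :=
  h 0 * l 1 ^ 2 - h 1 * l 0 * l 1 + h 2 * l 0 ^ 2

/-- The invariants of degrees 4, 8, 12 of the quintic. -/
def baseInv (b : Fin (5+1) → R) : Fin 3 → R :=
  ![quadDisc (quadCov b), quadPairing (quadCov b) (hessianCov (cubicCov b)),
    cubicDisc (cubicCov b)]

/-- The skew invariant of degree 18 of the quintic. -/
def skewInv (b : Fin (5+1) → R) : R :=
  quadAtRoot (jacCov (quadCov b) (hessianCov (cubicCov b))) (linCov (quadCov b) (cubicCov b))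

theorem map_baseInv {S : Type*} [CommRing S] (φ : R →+* S) (b : Fin (5+1) → R) (k : Fin 3) :
    φ (baseInv b k) = baseInv (fun i => φ (b i)) k := by
  fin_cases k <;>
    simp [baseInv, quadDisc, quadCov, quadPairing, hessianCov, cubicCov, cubicDisc, map_ofNat]

theorem map_skewInv {S : Type*} [CommRing S] (φ : R →+* S) (b : Fin (5+1) → R) :
    φ (skewInv b) = skewInv (fun i => φ (b i)) := by
  simp [skewInv, quadAtRoot, jacCov, linCov, quadCov, hessianCov, cubicCov, map_ofNat]

/-- The action of `x ↦ x + t y` on normalized coefficients of a quintic. -/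
def shiftQuintic (t : R) (b : Fin (5+1) → R) : Fin (5+1) → R :=
  ![b 0, b 1 + t * b 0, b 2 + 2 * t * b 1 + t ^ 2 * b 0,
    b 3 + 3 * t * b 2 + 3 * t ^ 2 * b 1 + t ^ 3 * b 0,
    b 4 + 4 * t * b 3 + 6 * t ^ 2 * b 2 + 4 * t ^ 3 * b 1 + t ^ 4 * b 0,
    b 5 + 5 * t * b 4 + 10 * t ^ 2 * b 3 + 10 * t ^ 3 * b 2 + 5 * t ^ 4 * b 1 + t ^ 5 * b 0]

def shiftQuad (t : R) (i : Fin 3 → R) : Fin 3 → R :=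
  ![i 0, i 1 + 2 * t * i 0, i 2 + t * i 1 + t ^ 2 * i 0]

def shiftCubic (t : R) (j : Fin 4 → R) : Fin 4 → R :=
  ![j 0, j 1 + 3 * t * j 0, j 2 + 2 * t * j 1 + 3 * t ^ 2 * j 0,
    j 3 + t * j 2 + t ^ 2 * j 1 + t ^ 3 * j 0]

def shiftLin (t : R) (l : Fin 2 → R) : Fin 2 → R := ![l 0, l 1 + t * l 0]

theorem quadCov_shift (t : R) (b : Fin (5+1) → R) :
    quadCov (shiftQuintic t b) = shiftQuad t (quadCov b) := by
  funext k
  fin_cases k <;> simp [quadCov, shiftQuintic, shiftQuad] <;> ring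

theorem cubicCov_shift (t : R) (b : Fin (5+1) → R) :
    cubicCov (shiftQuintic t b) = shiftCubic t (cubicCov b) := by
  funext k
  fin_cases k <;> simp [cubicCov, shiftQuintic, shiftCubic] <;> ring

theorem hessianCov_shift (t : R) (j : Fin 4 → R) :
    hessianCov (shiftCubic t j) = shiftQuad t (hessianCov j) := by
  funext k
  fin_cases k <;> simp [hessianCov, shiftCubic, shiftQuad] <;> ring

theorem linCov_shift (t : R) (i : Fin 3 → R) (j : Fin 4 → R) :
    linCov (shiftQuad t i) (shiftCubic t j) = shiftLin t (linCov i j) := by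
  funext k
  fin_cases k <;> simp [linCov, shiftCubic, shiftQuad, shiftLin] <;> ring

theorem jacCov_shift (t : R) (i h : Fin 3 → R) :
    jacCov (shiftQuad t i) (shiftQuad t h) = shiftQuad t (jacCov i h) := by
  funext k
  fin_cases k <;> simp [jacCov, shiftQuad] <;> ring

theorem baseInv_shift (t : R) (b : Fin (5+1) → R) : baseInv (shiftQuintic t b) = baseInv b := by
  funext k
  simp only [baseInv, quadCov_shift, cubicCov_shift, hessianCov_shift]
  generalize quadCov b = i
  generalize hessianCov (cubicCov b) = h
  generalize cubicCov b = j
  fin_cases k <;> simp [quadDisc, quadPairing, cubicDisc, shiftQuad, shiftCubic] <;> ring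

theorem skewInv_shift (t : R) (b : Fin (5+1) → R) : skewInv (shiftQuintic t b) = skewInv b := by
  simp only [skewInv, quadCov_shift, cubicCov_shift, hessianCov_shift, linCov_shift, jacCov_shift]
  generalize jacCov (quadCov b) (hessianCov (cubicCov b)) = h
  generalize linCov (quadCov b) (cubicCov b) = l
  simp [quadAtRoot, shiftQuad, shiftLin]
  ring

/-- Exchange of the two variables `x` and `y`. -/
theorem baseInv_rev (b : Fin (5+1) → R) : baseInv (fun i => b i.rev) = baseInv b := by
  have hi : quadCov (fun i => b i.rev) = fun k => quadCov b k.rev := by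
    funext k
    fin_cases k <;> simp [quadCov, Fin.rev] <;> ring
  have hj : cubicCov (fun i => b i.rev) = fun k => cubicCov b k.rev := by
    funext k
    fin_cases k <;> simp [cubicCov, Fin.rev] <;> ring
  simp only [baseInv, hi, hj]
  generalize quadCov b = i
  generalize cubicCov b = j
  funext k
  fin_cases k <;> simp [quadDisc, quadPairing, hessianCov, cubicDisc, Fin.rev] <;> ring

theorem skewInv_rev (b : Fin (5+1) → R) : skewInv (fun i => b i.rev) = - skewInv b := by
  have hi : quadCov (fun i => b i.rev) = fun k => quadCov b k.rev := by
    funext k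
    fin_cases k <;> simp [quadCov, Fin.rev] <;> ring
  have hj : cubicCov (fun i => b i.rev) = fun k => cubicCov b k.rev := by
    funext k
    fin_cases k <;> simp [cubicCov, Fin.rev] <;> ring
  simp only [skewInv, hi, hj]
  generalize quadCov b = i
  generalize cubicCov b = j
  simp [quadAtRoot, jacCov, linCov, hessianCov, Fin.rev]
  ring

end Covariants

/-- The normalized coefficients of the generic quintic. -/
def genericCoeff (i : Fin (5+1)) : MvPolynomial (Fin (5+1)) ℂ :=
  C (Nat.choose 5 i : ℂ)⁻¹ * X i

def normCoeff (a : Fin (5+1) → ℂ) (i : Fin (5+1)) : ℂ := (Nat.choose 5 i : ℂ)⁻¹ * a i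

def ofNormCoeff (b : Fin (5+1) → ℂ) (i : Fin (5+1)) : ℂ := (Nat.choose 5 i : ℂ) * b i

theorem choose_five_ne_zero (i : Fin (5+1)) : (Nat.choose 5 i : ℂ) ≠ 0 := by
  exact_mod_cast (Nat.choose_pos (Nat.lt_succ_iff.mp i.2)).ne'

theorem normCoeff_ofNormCoeff (b : Fin (5+1) → ℂ) : normCoeff (ofNormCoeff b) = b := by
  funext i
  simp only [normCoeff, ofNormCoeff]
  rw [inv_mul_cancel_left₀ (choose_five_ne_zero i)]

theorem ofNormCoeff_normCoeff (a : Fin (5+1) → ℂ) : ofNormCoeff (normCoeff a) = a := by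
  funext i
  simp only [normCoeff, ofNormCoeff]
  rw [mul_inv_cancel_left₀ (choose_five_ne_zero i)]

def basePoly (k : Fin 3) : MvPolynomial (Fin (5+1)) ℂ := baseInv genericCoeff k

def skewPoly : MvPolynomial (Fin (5+1)) ℂ := skewInv genericCoeff

theorem eval_genericCoeff (a : Fin (5+1) → ℂ) (i : Fin (5+1)) :
    eval a (genericCoeff i) = normCoeff a i := by
  simp [genericCoeff, normCoeff]

theorem eval_basePoly (a : Fin (5+1) → ℂ) (k : Fin 3) :
    eval a (basePoly k) = baseInv (normCoeff a) k := by
  rw [basePoly, map_baseInv]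
  simp only [eval_genericCoeff]

theorem eval_skewPoly (a : Fin (5+1) → ℂ) : eval a skewPoly = skewInv (normCoeff a) := by
  rw [skewPoly, map_skewInv]
  simp only [eval_genericCoeff]

theorem quinticVal_ofNormCoeff (b : Fin (5+1) → ℂ) (x y : ℂ) :
    quinticVal (ofNormCoeff b) x y = b 0 * x ^ 5 + 5 * b 1 * x ^ 4 * y +
      10 * b 2 * x ^ 3 * y ^ 2 + 10 * b 3 * x ^ 2 * y ^ 3 + 5 * b 4 * x * y ^ 4 + b 5 * y ^ 5 := by
  simp [quinticVal, ofNormCoeff, Nat.choose]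

theorem sl2Act_upperUnipotent (t : ℂ) (b : Fin (5+1) → ℂ) :
    sl2Act 5 (upperUnipotent t) (ofNormCoeff b) = ofNormCoeff (shiftQuintic t b) := by
  refine quinticVal_injective fun x y => ?_
  rw [quinticVal_sl2Act, quinticVal_ofNormCoeff, quinticVal_ofNormCoeff]
  simp [upperUnipotent, shiftQuintic]
  ring

theorem sl2Act_lowerUnipotent (t : ℂ) (b : Fin (5+1) → ℂ) :
    sl2Act 5 (lowerUnipotent t) (ofNormCoeff fun i => b i.rev) =
      ofNormCoeff (fun i => shiftQuintic t b i.rev) := by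
  refine quinticVal_injective fun x y => ?_
  rw [quinticVal_sl2Act, quinticVal_ofNormCoeff, quinticVal_ofNormCoeff]
  simp [lowerUnipotent, shiftQuintic, Fin.rev]
  ring

theorem mem_invariantRing_of_shift (p : MvPolynomial (Fin (5+1)) ℂ)
    (hU : ∀ t b, eval (ofNormCoeff (shiftQuintic t b)) p = eval (ofNormCoeff b) p) (s : ℂ)
    (hr : ∀ b : Fin (5+1) → ℂ, eval (ofNormCoeff fun i => b i.rev) p = s * eval (ofNormCoeff b) p) :
    p ∈ invariantRing 5 := by
  refine mem_invariantRing_of_unipotent p (fun t a => ?_) (fun t a => ?_)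
  · rw [← ofNormCoeff_normCoeff a, sl2Act_upperUnipotent, hU]
  · obtain ⟨b, rfl⟩ : ∃ b : Fin (5+1) → ℂ, a = ofNormCoeff fun i => b i.rev :=
      ⟨fun k => normCoeff a k.rev, by
        simp only [Fin.rev_rev]
        exact (ofNormCoeff_normCoeff a).symm⟩
    rw [sl2Act_lowerUnipotent, hr, hU, ← hr]

theorem basePoly_mem (k : Fin 3) : basePoly k ∈ invariantRing 5 := by
  refine mem_invariantRing_of_shift _ (fun t b => ?_) 1 (fun b => ?_)
  · rw [eval_basePoly, eval_basePoly, normCoeff_ofNormCoeff, normCoeff_ofNormCoeff, baseInv_shift]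
  · rw [eval_basePoly, eval_basePoly, normCoeff_ofNormCoeff, normCoeff_ofNormCoeff, baseInv_rev,
      one_mul]

theorem skewPoly_mem : skewPoly ∈ invariantRing 5 := by
  refine mem_invariantRing_of_shift _ (fun t b => ?_) (-1) (fun b => ?_)
  · rw [eval_skewPoly, eval_skewPoly, normCoeff_ofNormCoeff, normCoeff_ofNormCoeff, skewInv_shift]
  · rw [eval_skewPoly, eval_skewPoly, normCoeff_ofNormCoeff, normCoeff_ofNormCoeff, skewInv_rev,
      neg_one_mul]

theorem exists_roots_cubic (s₁ s₂ s₃ : ℂ) :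
    ∃ r₁ r₂ r₃ : ℂ, r₁ + r₂ + r₃ = s₁ ∧ r₁ * r₂ + r₁ * r₃ + r₂ * r₃ = s₂ ∧ r₁ * r₂ * r₃ = s₃ := by
  obtain ⟨r, hr⟩ := IsAlgClosed.exists_root
    (Polynomial.X ^ 3 - Polynomial.C s₁ * Polynomial.X ^ 2 + Polynomial.C s₂ * Polynomial.X -
      Polynomial.C s₃) (by
        have : (Polynomial.X ^ 3 - Polynomial.C s₁ * Polynomial.X ^ 2 +
          Polynomial.C s₂ * Polynomial.X - Polynomial.C s₃ : Polynomial ℂ).degree = 3 := by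
          compute_degree!
        rw [this]
        norm_num)
  obtain ⟨δ, hδ⟩ := IsAlgClosed.exists_pow_nat_eq ((s₁ - r) ^ 2 - 4 * (s₂ - r * (s₁ - r)))
    (n := 2) two_pos
  simp [Polynomial.IsRoot.def] at hr
  refine ⟨r, (s₁ - r + δ) / 2, (s₁ - r - δ) / 2, by ring, ?_, ?_⟩
  · linear_combination (-1 / 4) * hδ
  · linear_combination (-r / 4) * hδ + hr

/-- Coefficients of the quintic `u x^5 + v y^5 - w (x + y)^5`. -/
def sylvester (u v w : ℂ) : Fin (5+1) → ℂ := ofNormCoeff ![u - w, -w, -w, -w, -w, v - w]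

theorem quinticVal_sylvester (u v w x y : ℂ) :
    quinticVal (sylvester u v w) x y = u * x ^ 5 + v * y ^ 5 - w * (x + y) ^ 5 := by
  rw [sylvester, quinticVal_ofNormCoeff]
  simp
  ring

theorem exists_sum_of_fifth_powers {b : Fin (5+1) → ℂ} (h0 : cubicCov b 0 ≠ 0)
    (hd : cubicDisc (cubicCov b) ≠ 0) :
    ∃ r₁ r₂ r₃ c₁ c₂ c₃ : ℂ, r₁ ≠ r₂ ∧ r₁ ≠ r₃ ∧ r₂ ≠ r₃ ∧
      ∀ k : Fin (5+1), b k = c₁ * r₁ ^ (k : ℕ) + c₂ * r₂ ^ (k : ℕ) + c₃ * r₃ ^ (k : ℕ) := by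
  obtain ⟨r₁, r₂, r₃, e1, e2, e3⟩ := exists_roots_cubic (cubicCov b 1 / cubicCov b 0)
    (cubicCov b 2 / cubicCov b 0) (cubicCov b 3 / cubicCov b 0)
  rw [eq_div_iff h0] at e1 e2 e3
  have hd' : cubicDisc (cubicCov b) =
      cubicCov b 0 ^ 4 * ((r₁ - r₂) * (r₁ - r₃) * (r₂ - r₃)) ^ 2 := by
    rw [cubicDisc, ← e1, ← e2, ← e3]
    ring
  have h12 : r₁ ≠ r₂ := fun h => hd (by rw [hd', h]; ring)
  have h13 : r₁ ≠ r₃ := fun h => hd (by rw [hd', h]; ring)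
  have h23 : r₂ ≠ r₃ := fun h => hd (by rw [hd', h]; ring)
  have s12 := sub_ne_zero.mpr h12
  have s13 := sub_ne_zero.mpr h13
  have s23 := sub_ne_zero.mpr h23
  have rec0 : b 3 = (r₁ + r₂ + r₃) * b 2 - (r₁ * r₂ + r₁ * r₃ + r₂ * r₃) * b 1 +
      r₁ * r₂ * r₃ * b 0 := by
    refine mul_right_cancel₀ h0 ?_
    linear_combination (exp := 1) - b 2 * e1 + b 1 * e2 - b 0 * e3 +
      (by simp [cubicCov]; ring : cubicCov b 3 * b 0 - cubicCov b 2 * b 1 + cubicCov b 1 * b 2 -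
        cubicCov b 0 * b 3 = 0) * (-1)
  have rec1 : b 4 = (r₁ + r₂ + r₃) * b 3 - (r₁ * r₂ + r₁ * r₃ + r₂ * r₃) * b 2 +
      r₁ * r₂ * r₃ * b 1 := by
    refine mul_right_cancel₀ h0 ?_
    linear_combination (exp := 1) - b 3 * e1 + b 2 * e2 - b 1 * e3 +
      (by simp [cubicCov]; ring : cubicCov b 3 * b 1 - cubicCov b 2 * b 2 + cubicCov b 1 * b 3 -
        cubicCov b 0 * b 4 = 0) * (-1)
  have rec2 : b 5 = (r₁ + r₂ + r₃) * b 4 - (r₁ * r₂ + r₁ * r₃ + r₂ * r₃) * b 3 +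
      r₁ * r₂ * r₃ * b 2 := by
    refine mul_right_cancel₀ h0 ?_
    linear_combination (exp := 1) - b 4 * e1 + b 3 * e2 - b 2 * e3 +
      (by simp [cubicCov]; ring : cubicCov b 3 * b 2 - cubicCov b 2 * b 3 + cubicCov b 1 * b 4 -
        cubicCov b 0 * b 5 = 0) * (-1)
  obtain ⟨c₁, hc1⟩ : ∃ c, c = (b 2 - (r₂ + r₃) * b 1 + r₂ * r₃ * b 0) / ((r₁ - r₂) * (r₁ - r₃)) :=
    ⟨_, rfl⟩
  obtain ⟨c₂, hc2⟩ : ∃ c, c = (b 2 - (r₁ + r₃) * b 1 + r₁ * r₃ * b 0) / ((r₂ - r₁) * (r₂ - r₃)) :=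
    ⟨_, rfl⟩
  obtain ⟨c₃, hc3⟩ : ∃ c, c = (b 2 - (r₁ + r₂) * b 1 + r₁ * r₂ * b 0) / ((r₃ - r₁) * (r₃ - r₂)) :=
    ⟨_, rfl⟩
  have s21 := sub_ne_zero.mpr h12.symm
  have s31 := sub_ne_zero.mpr h13.symm
  have s32 := sub_ne_zero.mpr h23.symm
  have v0 : b 0 = c₁ + c₂ + c₃ := by
    rw [hc1, hc2, hc3]
    field_simp
    ring
  have v1 : b 1 = c₁ * r₁ + c₂ * r₂ + c₃ * r₃ := by
    rw [hc1, hc2, hc3]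
    field_simp
    ring
  have v2 : b 2 = c₁ * r₁ ^ 2 + c₂ * r₂ ^ 2 + c₃ * r₃ ^ 2 := by
    rw [hc1, hc2, hc3]
    field_simp
    ring
  have v3 : b 3 = c₁ * r₁ ^ 3 + c₂ * r₂ ^ 3 + c₃ * r₃ ^ 3 := by
    rw [rec0, v2, v1, v0]
    ring
  have v4 : b 4 = c₁ * r₁ ^ 4 + c₂ * r₂ ^ 4 + c₃ * r₃ ^ 4 := by
    rw [rec1, v3, v2, v1]
    ring
  have v5 : b 5 = c₁ * r₁ ^ 5 + c₂ * r₂ ^ 5 + c₃ * r₃ ^ 5 := by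
    rw [rec2, v4, v3, v2]
    ring
  refine ⟨r₁, r₂, r₃, c₁, c₂, c₃, h12, h13, h23, fun k => ?_⟩
  fin_cases k
  · simpa using v0
  · simpa using v1
  · exact v2
  · exact v3
  · exact v4
  · exact v5

theorem exists_sl2Act_quinticVal {p q r s : ℂ} (h : p * s - q * r = 1) :
    ∃ g : Matrix.SpecialLinearGroup (Fin 2) ℂ, ∀ a x y,
      quinticVal (sl2Act 5 g a) x y = quinticVal a (p * x + q * y) (r * x + s * y) := by
  refine ⟨⟨!![p, q; r, s], by rw [Matrix.det_fin_two_of, h]⟩, fun a x y => ?_⟩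
  exact quinticVal_sl2Act _ a x y

theorem exists_sl2Act_eq_sylvester {a : Fin (5+1) → ℂ} (h0 : cubicCov (normCoeff a) 0 ≠ 0)
    (hd : cubicDisc (cubicCov (normCoeff a)) ≠ 0) :
    ∃ g u v w, sl2Act 5 g a = sylvester u v w := by
  obtain ⟨r₁, r₂, r₃, c₁, c₂, c₃, h12, h13, h23, hb⟩ := exists_sum_of_fifth_powers h0 hd
  have s12 := sub_ne_zero.mpr h12
  have s13 := sub_ne_zero.mpr h13
  have s32 := sub_ne_zero.mpr h23.symm
  obtain ⟨κ, hκ⟩ := IsAlgClosed.exists_pow_nat_eq (-(r₁ - r₂) / ((r₁ - r₃) * (r₃ - r₂)))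
    (n := 2) two_pos
  rw [eq_div_iff (mul_ne_zero s13 s32)] at hκ
  have hval : ∀ x y, quinticVal a x y =
      c₁ * (x + r₁ * y) ^ 5 + c₂ * (x + r₂ * y) ^ 5 + c₃ * (x + r₃ * y) ^ 5 := by
    intro x y
    rw [← ofNormCoeff_normCoeff a, quinticVal_ofNormCoeff, hb, hb, hb, hb, hb, hb]
    simp
    ring
  obtain ⟨g, hg⟩ := exists_sl2Act_quinticVal (p := -r₂ * (κ * (r₁ - r₃)) / (r₁ - r₂))
    (q := r₁ * (κ * (r₃ - r₂)) / (r₁ - r₂)) (r := κ * (r₁ - r₃) / (r₁ - r₂))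
    (s := -(κ * (r₃ - r₂)) / (r₁ - r₂)) (by
      field_simp
      linear_combination (-(r₁ - r₂)) * hκ)
  refine ⟨g, c₁ * (κ * (r₁ - r₃)) ^ 5, c₂ * (κ * (r₃ - r₂)) ^ 5,
    -(c₃ * (κ * (r₁ - r₃) * (r₃ - r₂) / (r₁ - r₂)) ^ 5), ?_⟩
  refine quinticVal_injective fun x y => ?_
  rw [hg, hval, quinticVal_sylvester]
  have e1 : -r₂ * (κ * (r₁ - r₃)) / (r₁ - r₂) * x + r₁ * (κ * (r₃ - r₂)) / (r₁ - r₂) * y +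
      r₁ * (κ * (r₁ - r₃) / (r₁ - r₂) * x + -(κ * (r₃ - r₂)) / (r₁ - r₂) * y) =
      κ * (r₁ - r₃) * x := by
    field_simp
    ring
  have e2 : -r₂ * (κ * (r₁ - r₃)) / (r₁ - r₂) * x + r₁ * (κ * (r₃ - r₂)) / (r₁ - r₂) * y +
      r₂ * (κ * (r₁ - r₃) / (r₁ - r₂) * x + -(κ * (r₃ - r₂)) / (r₁ - r₂) * y) =
      κ * (r₃ - r₂) * y := by
    field_simp
    ring
  have e3 : -r₂ * (κ * (r₁ - r₃)) / (r₁ - r₂) * x + r₁ * (κ * (r₃ - r₂)) / (r₁ - r₂) * y +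
      r₃ * (κ * (r₁ - r₃) / (r₁ - r₂) * x + -(κ * (r₃ - r₂)) / (r₁ - r₂) * y) =
      κ * (r₁ - r₃) * (r₃ - r₂) / (r₁ - r₂) * (x + y) := by
    field_simp
    ring
  rw [e1, e2, e3]
  ring

theorem eval_basePoly_ofNormCoeff (b : Fin (5+1) → ℂ) (k : Fin 3) :
    eval (ofNormCoeff b) (basePoly k) = baseInv b k := by
  rw [eval_basePoly, normCoeff_ofNormCoeff]

theorem eval_skewPoly_ofNormCoeff (b : Fin (5+1) → ℂ) :
    eval (ofNormCoeff b) skewPoly = skewInv b := by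
  rw [eval_skewPoly, normCoeff_ofNormCoeff]

theorem eval_basePoly_sylvester (u v w : ℂ) (k : Fin 3) :
    eval (sylvester u v w) (basePoly k) =
      ![(u * v + u * w + v * w) ^ 2 - 4 * (u + v + w) * (u * v * w),
        (u * v + u * w + v * w) * (u * v * w) ^ 2, (u * v * w) ^ 4] k := by
  rw [sylvester, eval_basePoly_ofNormCoeff]
  fin_cases k <;> simp [baseInv, quadDisc, quadCov, quadPairing, hessianCov, cubicCov, cubicDisc]
    <;> ring

theorem eval_skewPoly_sylvester (u v w : ℂ) :
    eval (sylvester u v w) skewPoly =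
      -3 * (u * v * w) ^ 5 * ((u - v) * (v - w) * (w - u)) := by
  rw [sylvester, eval_skewPoly_ofNormCoeff]
  simp [skewInv, quadAtRoot, jacCov, linCov, quadCov, hessianCov, cubicCov]
  ring

theorem basePoly_two_ne_zero : basePoly 2 ≠ 0 := by
  intro h
  have := eval_basePoly_sylvester 1 1 1 2
  rw [h] at this
  simp at this

/-- An invariant of the quintic is determined by its values on sums of three fifth powers. -/
theorem eq_zero_of_eval_sylvester {T : MvPolynomial (Fin (5+1)) ℂ} (hT : T ∈ invariantRing 5)
    (h : ∀ u v w, eval (sylvester u v w) T = 0) : T = 0 := by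
  have hj : ∀ a, eval a (cubicCov genericCoeff 0) = cubicCov (normCoeff a) 0 := by
    intro a
    simp [cubicCov, ← eval_genericCoeff]
  have hj0 : cubicCov genericCoeff 0 ≠ 0 := by
    intro h0
    have := hj (ofNormCoeff ![0, 0, 1, 0, 0, 0])
    rw [h0, normCoeff_ofNormCoeff] at this
    simp [cubicCov] at this
  have hz : T * (cubicCov genericCoeff 0 * basePoly 2) = 0 := by
    refine MvPolynomial.funext fun a => ?_
    rw [map_mul, map_mul, map_zero, hj, eval_basePoly]
    by_cases h0 : cubicCov (normCoeff a) 0 = 0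
    · rw [h0, zero_mul, mul_zero]
    · by_cases hd : baseInv (normCoeff a) 2 = 0
      · rw [hd, mul_zero, mul_zero]
      · obtain ⟨g, u, v, w, hg⟩ := exists_sl2Act_eq_sylvester h0 hd
        rw [← hT g a, hg, h, zero_mul]
  exact (mul_eq_zero.mp hz).resolve_right (mul_ne_zero hj0 basePoly_two_ne_zero)

theorem skewPoly_sq : 16 * skewPoly ^ 2 = 9 * (basePoly 0 * basePoly 1 ^ 4 +
    8 * basePoly 1 ^ 3 * basePoly 2 - 2 * basePoly 0 ^ 2 * basePoly 1 ^ 2 * basePoly 2 -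
    72 * basePoly 0 * basePoly 1 * basePoly 2 ^ 2 - 432 * basePoly 2 ^ 3 +
    basePoly 0 ^ 3 * basePoly 2 ^ 2) := by
  have hA := basePoly_mem 0
  have hB := basePoly_mem 1
  have hC := basePoly_mem 2
  have hD := skewPoly_mem
  refine sub_eq_zero.mp (eq_zero_of_eval_sylvester ?_ fun u v w => ?_)
  · have hn : ∀ n : ℕ, (n : MvPolynomial (Fin (5+1)) ℂ) ∈ invariantRing 5 := fun n => natCast_mem _ n
    refine sub_mem (mul_mem (hn 16) (pow_mem hD 2)) (mul_mem (hn 9) ?_)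
    refine add_mem (sub_mem (sub_mem (sub_mem (add_mem ?_ ?_) ?_) ?_) ?_) ?_
    · exact mul_mem hA (pow_mem hB 4)
    · exact mul_mem (mul_mem (hn 8) (pow_mem hB 3)) hC
    · exact mul_mem (mul_mem (mul_mem (hn 2) (pow_mem hA 2)) (pow_mem hB 2)) hC
    · exact mul_mem (mul_mem (mul_mem (hn 72) hA) hB) (pow_mem hC 2)
    · exact mul_mem (hn 432) (pow_mem hC 3)
    · exact mul_mem (pow_mem hA 3) (pow_mem hC 2)
  · simp only [map_sub, map_mul, map_add, map_pow, map_ofNat, eval_basePoly_sylvester,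
      eval_skewPoly_sylvester, Matrix.cons_val_zero, Matrix.cons_val_one, Matrix.cons_val]
    ring

theorem aeval_weighted_smul {σ S : Type*} [CommRing S] [Algebra ℂ S] {w : σ → ℕ} {n : ℕ}
    {p : MvPolynomial σ ℂ} (hp : p.IsWeightedHomogeneous w n) (c : S) (a : σ → S) :
    aeval (fun i => c ^ w i * a i) p = c ^ n * aeval a p := by
  rw [aeval_def, aeval_def, eval₂_eq, eval₂_eq, Finset.mul_sum]
  refine Finset.sum_congr rfl fun m hm => ?_
  have h := hp (mem_support_iff.mp hm)
  rw [Finsupp.weight_apply, Finsupp.sum] at h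
  simp_rw [mul_pow, Finset.prod_mul_distrib, ← pow_mul]
  rw [Finset.prod_pow_eq_pow_sum, ← h]
  simp_rw [smul_eq_mul, mul_comm (w _)]
  ring

theorem eval_weighted_smul {σ : Type*} {w : σ → ℕ} {n : ℕ} {p : MvPolynomial σ ℂ}
    (hp : p.IsWeightedHomogeneous w n) (c : ℂ) (a : σ → ℂ) :
    eval (fun i => c ^ w i * a i) p = c ^ n * eval a p := by
  simpa [aeval_eq_eval] using aeval_weighted_smul hp c a

theorem eval_smul_of_isHomogeneous {σ : Type*} {n : ℕ} {p : MvPolynomial σ ℂ}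
    (hp : p.IsHomogeneous n) (c : ℂ) (a : σ → ℂ) : eval (c • a) p = c ^ n * eval a p := by
  rw [← eval_weighted_smul hp c a]
  congr 2
  funext i
  simp

theorem smul_sylvester (c u v w : ℂ) :
    c • sylvester u v w = sylvester (c * u) (c * v) (c * w) := by
  funext i
  fin_cases i <;> simp [sylvester, ofNormCoeff] <;> ring

theorem quinticVal_smul (c : ℂ) (a : Fin (5+1) → ℂ) (x y : ℂ) :
    quinticVal (c • a) x y = c * quinticVal a x y := by
  simp only [quinticVal, Pi.smul_apply, smul_eq_mul]
  ring

theorem eval_sylvester_swap_left {P : MvPolynomial (Fin (5+1)) ℂ} (hP : P ∈ invariantRing 5)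
    {d : ℕ} (hd : P.IsHomogeneous d) (u v w : ℂ) :
    eval (sylvester u v w) P = Complex.I ^ d * eval (sylvester v u w) P := by
  obtain ⟨g, hg⟩ := exists_sl2Act_quinticVal (p := 0) (q := Complex.I) (r := Complex.I) (s := 0)
    (by simp)
  rw [← eval_smul_of_isHomogeneous hd, ← hP g]
  congr 2
  refine quinticVal_injective fun x y => ?_
  have h5 : Complex.I ^ 5 = Complex.I := by
    rw [Complex.I_pow_eq_pow_mod]
    simp
  rw [hg, quinticVal_smul, quinticVal_sylvester, quinticVal_sylvester]
  linear_combination (v * x ^ 5 + u * y ^ 5 - w * (x + y) ^ 5) * h5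

theorem eval_sylvester_swap_right {P : MvPolynomial (Fin (5+1)) ℂ} (hP : P ∈ invariantRing 5)
    {d : ℕ} (hd : P.IsHomogeneous d) (u v w : ℂ) :
    eval (sylvester u v w) P = Complex.I ^ d * eval (sylvester u w v) P := by
  obtain ⟨g, hg⟩ := exists_sl2Act_quinticVal (p := Complex.I) (q := 0) (r := -Complex.I)
    (s := -Complex.I) (by simp)
  rw [← eval_smul_of_isHomogeneous hd, ← hP g]
  congr 2
  refine quinticVal_injective fun x y => ?_
  have h5 : Complex.I ^ 5 = Complex.I := by
    rw [Complex.I_pow_eq_pow_mod]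
    simp
  rw [hg, quinticVal_smul, quinticVal_sylvester, quinticVal_sylvester]
  linear_combination (u * x ^ 5 - v * (x + y) ^ 5 + w * y ^ 5) * h5

theorem eq_zero_of_odd {P : MvPolynomial (Fin (5+1)) ℂ} (hP : P ∈ invariantRing 5)
    {d : ℕ} (hd : P.IsHomogeneous d) (hodd : Odd d) : P = 0 := by
  refine MvPolynomial.funext fun a => ?_
  obtain ⟨g, hg⟩ := exists_sl2Act_quinticVal (p := -1) (q := 0) (r := 0) (s := -1) (by simp)
  have h : sl2Act 5 g a = (-1 : ℂ) • a := by
    refine quinticVal_injective fun x y => ?_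
    rw [hg, quinticVal_smul]
    simp only [quinticVal]
    ring
  have h2 := hP g a
  rw [h, eval_smul_of_isHomogeneous hd, hodd.neg_one_pow] at h2
  rw [map_zero]
  linear_combination (-1 / 2) * h2

/-- The restriction of a polynomial to sums of three fifth powers. -/
def sylvesterRestrict : MvPolynomial (Fin (5+1)) ℂ →ₐ[ℂ] MvPolynomial (Fin 3) ℂ :=
  aeval fun i => C (Nat.choose 5 i : ℂ) * ![X 0 - X 2, -X 2, -X 2, -X 2, -X 2, X 1 - X 2] i

theorem eval_sylvesterRestrict (x : Fin 3 → ℂ) (P : MvPolynomial (Fin (5+1)) ℂ) :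
    eval x (sylvesterRestrict P) = eval (sylvester (x 0) (x 1) (x 2)) P := by
  have h : (aeval x).comp sylvesterRestrict = aeval (sylvester (x 0) (x 1) (x 2)) := by
    refine MvPolynomial.algHom_ext fun i => ?_
    fin_cases i <;> simp [sylvesterRestrict, sylvester, ofNormCoeff]
  simpa [aeval_eq_eval] using DFunLike.congr_fun h P

theorem isSymmetric_of_swaps {q : MvPolynomial (Fin 3) ℂ}
    (h01 : ∀ u v w, eval ![u, v, w] q = eval ![v, u, w] q)
    (h12 : ∀ u v w, eval ![u, v, w] q = eval ![u, w, v] q) : q.IsSymmetric := by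
  have key : ∀ e : Equiv.Perm (Fin 3), ∀ x : Fin 3 → ℂ, eval (x ∘ e) q = eval x q := by
    intro e
    have he : e ∈ Submonoid.closure
        (Set.range fun i : Fin 2 => Equiv.swap i.castSucc i.succ) := by
      rw [Equiv.Perm.mclosure_swap_castSucc_succ]
      trivial
    induction he using Submonoid.closure_induction with
    | mem e he =>
      obtain ⟨i, rfl⟩ := he
      intro x
      have hx : x = ![x 0, x 1, x 2] := by
        funext k
        fin_cases k <;> rfl
      fin_cases i
      · have h := h01 (x 1) (x 0) (x 2)
        rw [← hx] at h
        rw [← h]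
        congr 2
        funext k
        fin_cases k <;> simp [Equiv.swap_apply_of_ne_of_ne]
      · have h := h12 (x 0) (x 2) (x 1)
        rw [← hx] at h
        rw [← h]
        congr 2
        funext k
        fin_cases k <;> simp [Equiv.swap_apply_of_ne_of_ne]
    | one => intro x; rfl
    | mul e f _ _ he hf =>
      intro x
      rw [← he x, ← hf (x ∘ e)]
      rfl
  intro e
  refine MvPolynomial.funext fun x => ?_
  rw [eval_rename, key]

theorem eval_aeval {σ τ : Type*} (x : τ → ℂ) (f : σ → MvPolynomial τ ℂ) (q : MvPolynomial σ ℂ) :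
    eval x (aeval f q) = eval (fun i => eval x (f i)) q := by
  have h : (aeval x).comp (aeval f) = aeval (fun i => aeval x (f i)) := comp_aeval f (aeval x)
  simpa [aeval_eq_eval] using DFunLike.congr_fun h q

/-- Factor theorem: if `g` does not involve the variable `i` and `L * q` vanishes where
`x i = g x`, but `L` does not, then `X i - g` divides `q`. -/
theorem X_sub_dvd {σ : Type*} [DecidableEq σ] {i : σ} {g L q : MvPolynomial σ ℂ}
    (hg : ∀ x c, eval (Function.update x i c) g = eval x g)
    (hL : ∃ x : σ → ℂ, x i = eval x g ∧ eval x L ≠ 0)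
    (h : ∀ x : σ → ℂ, x i = eval x g → eval x (L * q) = 0) : X i - g ∣ q := by
  rw [← Ideal.mem_span_singleton, ← Ideal.Quotient.eq_zero_iff_mem]
  set I : Ideal (MvPolynomial σ ℂ) := Ideal.span {X i - g}
  have hx : ∀ x : σ → ℂ, (fun k => eval x ((Function.update X i g : σ → MvPolynomial σ ℂ) k)) =
      Function.update x i (eval x g) := by
    intro x
    funext k
    by_cases hk : k = i
    · rw [hk, Function.update_self, Function.update_self]
    · rw [Function.update_of_ne hk, Function.update_of_ne hk, eval_X]
  have hLq : aeval (Function.update X i g : σ → MvPolynomial σ ℂ) (L * q) = 0 := by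
    refine MvPolynomial.funext fun x => ?_
    rw [eval_aeval, hx, map_zero]
    refine h _ ?_
    rw [Function.update_self, hg]
  rw [map_mul, mul_eq_zero] at hLq
  have hq : aeval (Function.update X i g : σ → MvPolynomial σ ℂ) q = 0 := by
    refine hLq.resolve_left fun h0 => ?_
    obtain ⟨x, hxi, hxL⟩ := hL
    have h2 := congrArg (eval x) h0
    rw [eval_aeval, hx, ← hxi, Function.update_eq_self, map_zero] at h2
    exact hxL h2
  have hc : (Ideal.Quotient.mkₐ ℂ I).comp
      (aeval (Function.update X i g : σ → MvPolynomial σ ℂ)) = Ideal.Quotient.mkₐ ℂ I := by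
    refine MvPolynomial.algHom_ext fun k => ?_
    rw [AlgHom.comp_apply, aeval_X]
    by_cases hk : k = i
    · rw [hk, Function.update_self]
      symm
      rw [Ideal.Quotient.mkₐ_eq_mk, Ideal.Quotient.eq]
      exact Ideal.mem_span_singleton_self _
    · rw [Function.update_of_ne hk]
  have := DFunLike.congr_fun hc q
  rw [AlgHom.comp_apply, hq, map_zero] at this
  exact this.symm

theorem X_sub_X_dvd {i j : Fin 3} (hij : i ≠ j) {L q : MvPolynomial (Fin 3) ℂ}
    (hL : ∃ x : Fin 3 → ℂ, x i = x j ∧ eval x L ≠ 0)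
    (h : ∀ x : Fin 3 → ℂ, x i = x j → eval x (L * q) = 0) : X i - X j ∣ q := by
  refine X_sub_dvd (L := L) (fun x c => ?_) (by simpa using hL) (fun x hx => h x (by simpa using hx))
  rw [eval_X, eval_X, Function.update_of_ne hij.symm]

theorem coeff_aeval_C_mul_X {σ : Type*} (c : σ → ℂ) (q : MvPolynomial σ ℂ) (m : σ →₀ ℕ) :
    coeff m (aeval (fun i => (C (c i) * X i : MvPolynomial σ ℂ)) q) =
      (m.prod fun i k => c i ^ k) * coeff m q := by
  classical
  induction q using MvPolynomial.induction_on' with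
  | monomial n a =>
    have h : aeval (fun i => (C (c i) * X i : MvPolynomial σ ℂ)) (monomial n a) =
        monomial n ((n.prod fun i k => c i ^ k) * a) := by
      rw [aeval_monomial, monomial_eq (s := n)]
      simp only [mul_pow, Finsupp.prod_mul, algebraMap_eq, C_mul]
      rw [← mul_assoc, mul_comm (C a)]
      congr 2
      simp [Finsupp.prod]
    rw [h, coeff_monomial, coeff_monomial]
    split_ifs with hm
    · rw [hm]
    · rw [mul_zero]
  | add p q hp hq => rw [map_add, coeff_add, coeff_add, hp, hq, mul_add]

theorem sylvesterRestrict_basePoly (k : Fin 3) : sylvesterRestrict (basePoly k) =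
    ![(X 0 * X 1 + X 0 * X 2 + X 1 * X 2) ^ 2 - 4 * (X 0 + X 1 + X 2) * (X 0 * X 1 * X 2),
      (X 0 * X 1 + X 0 * X 2 + X 1 * X 2) * (X 0 * X 1 * X 2) ^ 2, (X 0 * X 1 * X 2) ^ 4] k := by
  refine MvPolynomial.funext fun x => ?_
  rw [eval_sylvesterRestrict, eval_basePoly_sylvester]
  fin_cases k <;> simp

theorem sylvesterRestrict_skewPoly : sylvesterRestrict skewPoly =
    -3 * (X 0 * X 1 * X 2) ^ 5 * ((X 0 - X 1) * (X 1 - X 2) * (X 2 - X 0)) := by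
  refine MvPolynomial.funext fun x => ?_
  rw [eval_sylvesterRestrict, eval_skewPoly_sylvester]
  simp

theorem eq_of_sylvesterRestrict_eq {P Q : MvPolynomial (Fin (5+1)) ℂ} (hP : P ∈ invariantRing 5)
    (hQ : Q ∈ invariantRing 5) (h : sylvesterRestrict P = sylvesterRestrict Q) : P = Q := by
  refine sub_eq_zero.mp (eq_zero_of_eval_sylvester (sub_mem hP hQ) fun u v w => ?_)
  have := eval_sylvesterRestrict ![u, v, w] (P - Q)
  rw [map_sub, h, sub_self, map_zero] at this
  exact this.symm

theorem aeval_basePoly_mem (Q : MvPolynomial (Fin 3) ℂ) : aeval basePoly Q ∈ invariantRing 5 := by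
  have h := Algebra.adjoin_le (S := invariantRing 5) (s := Set.range basePoly)
    (by rintro _ ⟨k, rfl⟩; exact basePoly_mem k)
  refine h ?_
  rw [Algebra.adjoin_range_eq_range_aeval]
  exact ⟨Q, rfl⟩

theorem esymm_fin_three_one : esymm (Fin 3) ℂ 1 = X 0 + X 1 + X 2 := by
  rw [esymm_one, Fin.sum_univ_three]

theorem esymm_fin_three_two : esymm (Fin 3) ℂ 2 = X 0 * X 1 + X 0 * X 2 + X 1 * X 2 := by
  have h : Finset.powersetCard 2 (Finset.univ : Finset (Fin 3)) = {{0, 1}, {0, 2}, {1, 2}} := by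
    decide
  rw [esymm, h, Finset.sum_insert (by decide), Finset.sum_insert (by decide),
    Finset.sum_singleton, Finset.prod_pair (by decide), Finset.prod_pair (by decide),
    Finset.prod_pair (by decide), add_assoc]

theorem esymm_fin_three_three : esymm (Fin 3) ℂ 3 = X 0 * X 1 * X 2 := by
  have h : Finset.powersetCard 3 (Finset.univ : Finset (Fin 3)) = {Finset.univ} := by
    decide
  rw [esymm, h, Finset.sum_singleton, Fin.prod_univ_three]

theorem isHomogeneous_esymm {σ : Type*} [Fintype σ] (n : ℕ) :
    (esymm σ ℂ n).IsHomogeneous n := by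
  refine IsHomogeneous.sum _ _ _ fun t ht => ?_
  have h := IsHomogeneous.prod t (fun i => (X i : MvPolynomial σ ℂ)) (fun _ => 1)
    fun i _ => isHomogeneous_X ℂ i
  rwa [Finset.sum_const, (Finset.mem_powersetCard.mp ht).2, smul_eq_mul, mul_one] at h

theorem exists_mul_eq_sylvesterRestrict {s : MvPolynomial (Fin 3) ℂ} (hs : s.IsSymmetric)
    (hI : ∀ x, eval (Complex.I • x) s = eval x s) :
    ∃ (N : ℕ) (Q : MvPolynomial (Fin 3) ℂ),
      (X 0 * X 1 * X 2) ^ (4 * N) * s = sylvesterRestrict (aeval basePoly Q) := by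
  obtain ⟨q, hq⟩ := esymmAlgHom_fin_surjective (R := ℂ) (n := 3) (m := 3) le_rfl ⟨s, hs⟩
  have hqs : aeval (fun i : Fin 3 => esymm (Fin 3) ℂ (i + 1)) q = s := by
    rw [← esymmAlgHom_apply, hq]
  have hinv : aeval (fun i : Fin 3 => (C (Complex.I ^ ((i : ℕ) + 1)) * X i :
      MvPolynomial (Fin 3) ℂ)) q = q := by
    refine esymmAlgHom_fin_injective ℂ (n := 3) (m := 3) le_rfl (Subtype.ext ?_)
    rw [esymmAlgHom_apply, esymmAlgHom_apply, hqs]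
    refine MvPolynomial.funext fun x => ?_
    rw [← hI x, ← hqs, eval_aeval, eval_aeval, eval_aeval]
    congr 2
    funext i
    rw [eval_smul_of_isHomogeneous (isHomogeneous_esymm _)]
    simp
  have hcoeff : ∀ m, coeff m q ≠ 0 → 4 ∣ m 0 + 2 * m 1 + 3 * m 2 := by
    intro m hm
    have h := coeff_aeval_C_mul_X (fun i : Fin 3 => Complex.I ^ ((i : ℕ) + 1)) q m
    rw [hinv, eq_comm, mul_eq_right₀ hm, Finsupp.prod_fintype _ _ (by simp),
      Fin.prod_univ_three] at h
    refine (IsPrimitiveRoot.pow_eq_one_iff_dvd Complex.isPrimitiveRoot_I _).mp ?_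
    rw [← h, ← pow_mul, ← pow_mul, ← pow_mul, ← pow_add, ← pow_add]
    congr 1
    simp
  have hgood : ∀ m ∈ q.support, ∃ (N : ℕ) (Q : MvPolynomial (Fin 3) ℂ), (X 0 * X 1 * X 2) ^ (4 * N) *
      aeval (fun i : Fin 3 => esymm (Fin 3) ℂ (i + 1)) (monomial m (coeff m q)) =
        sylvesterRestrict (aeval basePoly Q) := by
    intro m hm
    obtain ⟨l, hl⟩ : 4 ∣ 15 * m 0 + 6 * m 1 + m 2 := by
      have := hcoeff m (mem_support_iff.mp hm)
      omega
    refine ⟨5 * m 0 + 2 * m 1,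
      C (coeff m q) * ((C (1 / 4) * (X 1 ^ 2 - X 0 * X 2)) ^ m 0 * X 1 ^ m 1 * X 2 ^ l), ?_⟩
    rw [aeval_monomial, Finsupp.prod_fintype _ _ (by simp), Fin.prod_univ_three]
    simp only [map_mul, map_pow, map_sub, aeval_X, sylvesterRestrict_basePoly,
      algebraMap_eq, algHom_C]
    simp only [Fin.val_zero, Fin.val_one, Fin.val_two, zero_add, Nat.reduceAdd,
      Matrix.cons_val_zero, Matrix.cons_val_one, Matrix.cons_val, esymm_fin_three_one,
      esymm_fin_three_two, esymm_fin_three_three]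
    generalize (X 0 * X 1 * X 2 : MvPolynomial (Fin 3) ℂ) = e₃
    generalize (X 0 * X 1 + X 0 * X 2 + X 1 * X 2 : MvPolynomial (Fin 3) ℂ) = e₂
    generalize (X 0 + X 1 + X 2 : MvPolynomial (Fin 3) ℂ) = e₁
    have h4 : (C (1 / 4) * 4 : MvPolynomial (Fin 3) ℂ) = 1 := by
      rw [← map_ofNat (C : ℂ →+* MvPolynomial (Fin 3) ℂ) 4, ← C_mul]
      norm_num
    have h5 : C (1 / 4) * ((e₂ * e₃ ^ 2) ^ 2 - (e₂ ^ 2 - 4 * e₁ * e₃) * e₃ ^ 4) = e₁ * e₃ ^ 5 := by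
      linear_combination e₁ * e₃ ^ 5 * h4
    rw [h5, ← pow_mul, ← hl, mul_pow, mul_pow, ← pow_mul, ← pow_mul]
    have e : e₃ ^ (4 * (5 * m 0 + 2 * m 1)) * e₃ ^ m 2 =
        e₃ ^ (5 * m 0) * e₃ ^ (2 * m 1) * e₃ ^ (15 * m 0 + 6 * m 1 + m 2) := by
      rw [← pow_add, ← pow_add, ← pow_add]
      congr 1
      ring
    linear_combination C (coeff m q) * e₁ ^ m 0 * e₂ ^ m 1 * e
  rw [← hqs, q.as_sum, map_sum]
  refine Finset.sum_induction _ (fun s => ∃ (N : ℕ) (Q : MvPolynomial (Fin 3) ℂ),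
    (X 0 * X 1 * X 2) ^ (4 * N) * s = sylvesterRestrict (aeval basePoly Q)) ?_ ⟨0, 0, by simp⟩ ?_
  · rintro a b ⟨N, Q, h⟩ ⟨N', Q', h'⟩
    refine ⟨N + N', X 2 ^ N' * Q + X 2 ^ N * Q', ?_⟩
    have h2 : (X 0 * X 1 * X 2 : MvPolynomial (Fin 3) ℂ) ^ 4 = sylvesterRestrict (basePoly 2) := by
      rw [sylvesterRestrict_basePoly]
      rfl
    simp only [map_add, map_mul, map_pow, aeval_X]
    rw [← h, ← h', ← h2]
    ring
  · simpa only [support_sum_monomial_coeff] using hgood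

theorem I_pow_of_four_dvd {d : ℕ} (h : 4 ∣ d) : Complex.I ^ d = 1 :=
  (IsPrimitiveRoot.pow_eq_one_iff_dvd Complex.isPrimitiveRoot_I d).mpr h

theorem I_pow_of_mod_four_eq_two {d : ℕ} (h : d % 4 = 2) : Complex.I ^ d = -1 := by
  rw [Complex.I_pow_eq_pow_mod, h, Complex.I_sq]

theorem eval_I_smul_sylvesterRestrict {P : MvPolynomial (Fin (5+1)) ℂ} {d : ℕ}
    (hd : P.IsHomogeneous d) (x : Fin 3 → ℂ) :
    eval (Complex.I • x) (sylvesterRestrict P) = Complex.I ^ d * eval x (sylvesterRestrict P) := by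
  rw [eval_sylvesterRestrict, eval_sylvesterRestrict, ← eval_smul_of_isHomogeneous hd,
    smul_sylvester]
  rfl

theorem exists_pow_mul_eq_of_four_dvd {P : MvPolynomial (Fin (5+1)) ℂ} (hP : P ∈ invariantRing 5)
    {d : ℕ} (hd : P.IsHomogeneous d) (h4 : 4 ∣ d) :
    ∃ (N : ℕ) (Q : MvPolynomial (Fin 3) ℂ), basePoly 2 ^ N * P = aeval basePoly Q := by
  obtain ⟨N, Q, h⟩ := exists_mul_eq_sylvesterRestrict (s := sylvesterRestrict P)
    (isSymmetric_of_swaps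
      (fun u v w => by
        rw [eval_sylvesterRestrict, eval_sylvesterRestrict]
        simpa [I_pow_of_four_dvd h4] using eval_sylvester_swap_left hP hd u v w)
      (fun u v w => by
        rw [eval_sylvesterRestrict, eval_sylvesterRestrict]
        simpa [I_pow_of_four_dvd h4] using eval_sylvester_swap_right hP hd u v w))
    (fun x => by rw [eval_I_smul_sylvesterRestrict hd, I_pow_of_four_dvd h4, one_mul])
  refine ⟨N, Q, eq_of_sylvesterRestrict_eq (mul_mem (pow_mem (basePoly_mem 2) N) hP)
    (aeval_basePoly_mem Q) ?_⟩
  rw [← h, map_mul, map_pow, sylvesterRestrict_basePoly, pow_mul]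
  rfl

theorem eval_eq_of_mul_eq {V s : MvPolynomial (Fin 3) ℂ} (hV : V ≠ 0)
    (f : Fin 3 → MvPolynomial (Fin 3) ℂ) (c : ℂ)
    (h : ∀ x, eval x V * eval (fun k => eval x (f k)) s = eval x V * (c * eval x s))
    (x : Fin 3 → ℂ) : eval (fun k => eval x (f k)) s = c * eval x s := by
  have h2 : aeval f s = C c * s := by
    refine mul_left_cancel₀ hV (MvPolynomial.funext fun x => ?_)
    rw [map_mul, map_mul, map_mul, eval_C, eval_aeval, h]
  rw [← eval_aeval, h2, map_mul, eval_C]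

theorem vandermonde_ne_zero :
    ((X 0 - X 1) * (X 1 - X 2) * (X 2 - X 0) : MvPolynomial (Fin 3) ℂ) ≠ 0 := by
  intro h
  have := congrArg (eval ![0, 1, -1]) h
  simp only [map_mul, map_sub, eval_X, map_zero, Matrix.cons_val_zero, Matrix.cons_val_one,
    Matrix.cons_val] at this
  norm_num at this

/-- An antisymmetric polynomial in three variables is divisible by the Vandermonde product. -/
theorem exists_eq_vandermonde_mul {q : MvPolynomial (Fin 3) ℂ}
    (h01 : ∀ u v w, eval ![u, v, w] q = - eval ![v, u, w] q)
    (h12 : ∀ u v w, eval ![u, v, w] q = - eval ![u, w, v] q) :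
    ∃ s, q = (X 0 - X 1) * (X 1 - X 2) * (X 2 - X 0) * s ∧ s.IsSymmetric := by
  have hvec : ∀ x : Fin 3 → ℂ, x = ![x 0, x 1, x 2] := by
    intro x
    funext k
    fin_cases k <;> rfl
  obtain ⟨q₁, h1⟩ : X 0 - X 1 ∣ q := by
    refine X_sub_X_dvd (L := 1) (by decide) ⟨0, by simp⟩ fun x hx => ?_
    have := h01 (x 0) (x 0) (x 2)
    rw [one_mul, hvec x, ← hx]
    linear_combination (1 / 2) * this
  obtain ⟨q₂, h2⟩ : X 1 - X 2 ∣ q₁ := by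
    refine X_sub_X_dvd (L := X 0 - X 1) (by decide) ⟨![1, 0, 0], by simp⟩ fun x hx => ?_
    have := h12 (x 0) (x 1) (x 1)
    rw [← h1, hvec x, ← hx]
    linear_combination (1 / 2) * this
  obtain ⟨s, h3⟩ : X 2 - X 0 ∣ q₂ := by
    refine X_sub_X_dvd (L := (X 0 - X 1) * (X 1 - X 2)) (by decide) ⟨![1, 0, 1], by simp⟩
      fun x hx => ?_
    have e1 := h01 (x 0) (x 1) (x 0)
    have e2 := h12 (x 1) (x 0) (x 0)
    rw [mul_assoc, ← h2, ← h1, hvec x, hx]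
    linear_combination e1 - (1 / 2) * e2
  have hqs : q = (X 0 - X 1) * (X 1 - X 2) * (X 2 - X 0) * s := by
    rw [h1, h2, h3]
    ring
  have h01' : ∀ x, eval (fun k => eval x (![X 1, X 0, X 2] k : MvPolynomial (Fin 3) ℂ)) s =
      1 * eval x s := by
    refine eval_eq_of_mul_eq vandermonde_ne_zero _ _ fun x => ?_
    have e := h01 (x 0) (x 1) (x 2)
    rw [← hvec x] at e
    have hv : (fun k => eval x (![X 1, X 0, X 2] k : MvPolynomial (Fin 3) ℂ)) =
        ![x 1, x 0, x 2] := by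
      funext k
      fin_cases k <;> simp
    rw [hv]
    rw [hqs] at e
    simp only [map_mul, map_sub, eval_X, Matrix.cons_val_zero, Matrix.cons_val_one,
      Matrix.cons_val] at e ⊢
    linear_combination -e
  have h12' : ∀ x, eval (fun k => eval x (![X 0, X 2, X 1] k : MvPolynomial (Fin 3) ℂ)) s =
      1 * eval x s := by
    refine eval_eq_of_mul_eq vandermonde_ne_zero _ _ fun x => ?_
    have e := h12 (x 0) (x 1) (x 2)
    rw [← hvec x] at e
    have hv : (fun k => eval x (![X 0, X 2, X 1] k : MvPolynomial (Fin 3) ℂ)) =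
        ![x 0, x 2, x 1] := by
      funext k
      fin_cases k <;> simp
    rw [hv]
    rw [hqs] at e
    simp only [map_mul, map_sub, eval_X, Matrix.cons_val_zero, Matrix.cons_val_one,
      Matrix.cons_val] at e ⊢
    linear_combination -e
  refine ⟨s, hqs, isSymmetric_of_swaps (fun u v w => ?_) (fun u v w => ?_)⟩
  · rw [← one_mul (eval ![u, v, w] s), ← h01']
    congr 2
    funext k
    fin_cases k <;> simp
  · rw [← one_mul (eval ![u, v, w] s), ← h12']
    congr 2
    funext k
    fin_cases k <;> simp

theorem exists_pow_mul_eq_of_mod_four_eq_two {P : MvPolynomial (Fin (5+1)) ℂ}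
    (hP : P ∈ invariantRing 5) {d : ℕ} (hd : P.IsHomogeneous d) (h4 : d % 4 = 2) :
    ∃ (N : ℕ) (Q : MvPolynomial (Fin 3) ℂ),
      basePoly 2 ^ N * P = skewPoly * aeval basePoly Q := by
  obtain ⟨s, hs, hsym⟩ := exists_eq_vandermonde_mul (q := sylvesterRestrict P)
    (fun u v w => by
      rw [eval_sylvesterRestrict, eval_sylvesterRestrict]
      simpa [I_pow_of_mod_four_eq_two h4] using eval_sylvester_swap_left hP hd u v w)
    (fun u v w => by
      rw [eval_sylvesterRestrict, eval_sylvesterRestrict]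
      simpa [I_pow_of_mod_four_eq_two h4] using eval_sylvester_swap_right hP hd u v w)
  have hsI : ∀ x, eval (fun k => eval x (C Complex.I * X k)) s = -Complex.I * eval x s := by
    refine eval_eq_of_mul_eq vandermonde_ne_zero _ _ fun x => ?_
    have e := eval_I_smul_sylvesterRestrict hd x
    rw [I_pow_of_mod_four_eq_two h4, hs] at e
    have hv : (fun k => eval x (C Complex.I * X k : MvPolynomial (Fin 3) ℂ)) = Complex.I • x := by
      funext k
      simp
    rw [hv]
    simp at e ⊢
    have hI := Complex.I_sq
    set z := eval (Complex.I • x) s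
    have hI3 : Complex.I ^ 4 = 1 := by simp
    linear_combination Complex.I * e - z * (x 0 - x 1) * (x 1 - x 2) * (x 2 - x 0) * hI3
  have hsI' : ∀ x, eval (Complex.I • x) s = -Complex.I * eval x s := by
    intro x
    rw [← hsI x]
    congr 2
    funext k
    simp
  obtain ⟨N, Q, h⟩ := exists_mul_eq_sylvesterRestrict (s := (X 0 * X 1 * X 2) ^ 3 * s)
    (by
      refine IsSymmetric.mul ?_ hsym
      rw [← esymm_fin_three_three, ← mem_symmetricSubalgebra]
      exact pow_mem (esymm_isSymmetric (Fin 3) ℂ 3) 3)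
    (fun x => by
      rw [map_mul, map_mul, hsI']
      simp
      have hI : Complex.I ^ 2 = -1 := Complex.I_sq
      linear_combination (-(x 0 * x 1 * x 2) ^ 3 * eval x s *
        (Complex.I ^ 8 - Complex.I ^ 6 + Complex.I ^ 4 - Complex.I ^ 2 + 1)) * hI)
  refine ⟨N + 2, C (-1 / 3) * Q, eq_of_sylvesterRestrict_eq
    (mul_mem (pow_mem (basePoly_mem 2) _) hP) (mul_mem skewPoly_mem (aeval_basePoly_mem _)) ?_⟩
  have h3 : (C (-1 / 3) * (-3) : MvPolynomial (Fin 3) ℂ) = 1 := by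
    rw [← map_ofNat (C : ℂ →+* MvPolynomial (Fin 3) ℂ) 3, ← C_neg, ← C_mul]
    norm_num
  rw [map_mul, map_mul, map_mul, map_mul, algHom_C, algebraMap_eq, algHom_C, algebraMap_eq,
    sylvesterRestrict_skewPoly, ← h, map_pow, sylvesterRestrict_basePoly, hs]
  simp only [Matrix.cons_val]
  rw [← pow_mul]
  linear_combination (-(X 0 * X 1 * X 2) ^ (4 * N + 8) * ((X 0 - X 1) * (X 1 - X 2) * (X 2 - X 0))
    * s) * h3

theorem eval_basePoly_degenerate (s t : ℂ) (k : Fin 3) :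
    eval (ofNormCoeff ![s, t, 0, 0, 0, 1]) (basePoly k) = ![s ^ 2, -2 * t ^ 5, 0] k := by
  rw [eval_basePoly_ofNormCoeff]
  fin_cases k <;> simp [baseInv, quadDisc, quadCov, quadPairing, hessianCov, cubicCov, cubicDisc]
  ring

theorem skewPoly_degenerate_ne_zero {s t : ℂ} (hs : s ≠ 0) (ht : t ≠ 0) :
    eval (ofNormCoeff ![s, t, 0, 0, 0, 1]) skewPoly ≠ 0 := by
  intro h
  have := congrArg (eval (ofNormCoeff ![s, t, 0, 0, 0, 1])) skewPoly_sq
  simp [eval_basePoly_degenerate, h, hs, ht] at this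

theorem eval_aeval_basePoly (a : Fin (5+1) → ℂ) (Q : MvPolynomial (Fin 3) ℂ) :
    eval a (aeval basePoly Q) = eval (fun k => eval a (basePoly k)) Q :=
  eval_aeval a basePoly Q

theorem exists_eq_mul_aeval_of_pow_mul {P G : MvPolynomial (Fin (5+1)) ℂ}
    (hG : ∀ s t : ℂ, s ≠ 0 → t ≠ 0 → eval (ofNormCoeff ![s, t, 0, 0, 0, 1]) G ≠ 0) (N : ℕ) :
    ∀ Q : MvPolynomial (Fin 3) ℂ, basePoly 2 ^ N * P = G * aeval basePoly Q →
      ∃ Q' : MvPolynomial (Fin 3) ℂ, P = G * aeval basePoly Q' := by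
  induction N with
  | zero => exact fun Q hQ => ⟨Q, by simpa using hQ⟩
  | succ N ih =>
    intro Q hQ
    have h0 : ∀ s t : ℂ, s ≠ 0 → t ≠ 0 → eval ![s ^ 2, -2 * t ^ 5, 0] Q = 0 := by
      intro s t hs ht
      have h := congrArg (eval (ofNormCoeff ![s, t, 0, 0, 0, 1])) hQ
      rw [map_mul, map_mul, map_pow, eval_basePoly_degenerate, eval_aeval_basePoly] at h
      simp only [eval_basePoly_degenerate] at h
      have h' : eval (ofNormCoeff ![s, t, 0, 0, 0, 1]) G * eval ![s ^ 2, -2 * t ^ 5, 0] Q = 0 := by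
        refine Eq.trans ?_ (h.symm.trans ?_)
        · congr 2
        · simp
      exact (mul_eq_zero.mp h').resolve_left (hG s t hs ht)
    obtain ⟨Q', rfl⟩ : X 2 - 0 ∣ Q := by
      refine X_sub_dvd (L := X 0 * X 1) (by simp) ⟨![1, 1, 0], by simp⟩ fun x hx => ?_
      rw [map_mul, map_mul, eval_X, eval_X]
      by_cases hx0 : x 0 = 0
      · simp [hx0]
      by_cases hx1 : x 1 = 0
      · simp [hx1]
      obtain ⟨s, hs⟩ := IsAlgClosed.exists_pow_nat_eq (x 0) (n := 2) two_pos
      obtain ⟨t, ht⟩ := IsAlgClosed.exists_pow_nat_eq (-x 1 / 2) (n := 5) (by norm_num)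
      have hs0 : s ≠ 0 := by
        rintro rfl
        exact hx0 (by simpa using hs.symm)
      have ht0 : t ≠ 0 := by
        rintro rfl
        exact hx1 (by linear_combination 2 * ht)
      have h2 := h0 s t hs0 ht0
      have hv : ![s ^ 2, -2 * t ^ 5, 0] = x := by
        funext k
        fin_cases k
        · exact hs
        · simp [ht]
          ring
        · simpa using hx.symm
      rw [← hv, h2, mul_zero]
    refine ih Q' (mul_left_cancel₀ basePoly_two_ne_zero ?_)
    rw [map_mul, map_sub, map_zero, sub_zero, aeval_X] at hQ
    linear_combination hQ

theorem exists_eq_aeval_of_four_dvd {P : MvPolynomial (Fin (5+1)) ℂ} (hP : P ∈ invariantRing 5)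
    {d : ℕ} (hd : P.IsHomogeneous d) (h4 : 4 ∣ d) :
    ∃ Q : MvPolynomial (Fin 3) ℂ, P = aeval basePoly Q := by
  obtain ⟨N, Q, h⟩ := exists_pow_mul_eq_of_four_dvd hP hd h4
  simpa using exists_eq_mul_aeval_of_pow_mul (G := 1) (by simp) N Q (by rw [h, one_mul])

theorem exists_eq_skewPoly_mul_aeval {P : MvPolynomial (Fin (5+1)) ℂ}
    (hP : P ∈ invariantRing 5) {d : ℕ} (hd : P.IsHomogeneous d) (h4 : d % 4 = 2) :
    ∃ Q : MvPolynomial (Fin 3) ℂ, P = skewPoly * aeval basePoly Q := by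
  obtain ⟨N, Q, h⟩ := exists_pow_mul_eq_of_mod_four_eq_two hP hd h4
  exact exists_eq_mul_aeval_of_pow_mul (fun s t => skewPoly_degenerate_ne_zero) N Q h

theorem isWeightedHomogeneous_of_eval_two {σ : Type*} {w : σ → ℕ} {n : ℕ} {p : MvPolynomial σ ℂ}
    (h : ∀ x, eval (fun i => 2 ^ w i * x i) p = 2 ^ n * eval x p) :
    p.IsWeightedHomogeneous w n := by
  intro m hm
  have h2 : aeval (fun i => (C (2 ^ w i) * X i : MvPolynomial σ ℂ)) p = C (2 ^ n) * p := by
    refine MvPolynomial.funext fun x => ?_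
    rw [eval_aeval, map_mul, eval_C, ← h]
    simp
  have h3 := coeff_aeval_C_mul_X (fun i => 2 ^ w i) p m
  rw [h2, coeff_C_mul] at h3
  have h4 := mul_right_cancel₀ hm h3
  simp_rw [Finsupp.prod, ← pow_mul, Finset.prod_pow_eq_pow_sum] at h4
  have h5 : (2 : ℕ) ^ n = 2 ^ ∑ i ∈ m.support, w i * m i := by exact_mod_cast h4
  rw [Nat.pow_right_injective le_rfl h5, Finsupp.weight_apply, Finsupp.sum]
  simp_rw [smul_eq_mul, mul_comm]

theorem isHomogeneous_of_eval_two_smul {σ : Type*} {n : ℕ} {p : MvPolynomial σ ℂ}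
    (h : ∀ x : σ → ℂ, eval ((2 : ℂ) • x) p = 2 ^ n * eval x p) : p.IsHomogeneous n := by
  refine isWeightedHomogeneous_of_eval_two fun x => ?_
  rw [← h]
  congr 2
  funext i
  simp

theorem normCoeff_smul (c : ℂ) (a : Fin (5+1) → ℂ) : normCoeff (c • a) = c • normCoeff a := by
  funext i
  simp only [normCoeff, Pi.smul_apply, smul_eq_mul]
  ring

/-- The weights of the three basic invariants. -/
def baseWeight (k : Fin 3) : ℕ := k + 1

theorem quadCov_smul (c : ℂ) (b : Fin (5+1) → ℂ) : quadCov (c • b) = c ^ 2 • quadCov b := by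
  funext k
  fin_cases k <;> simp [quadCov] <;> ring

theorem cubicCov_smul (c : ℂ) (b : Fin (5+1) → ℂ) : cubicCov (c • b) = c ^ 3 • cubicCov b := by
  funext k
  fin_cases k <;> simp [cubicCov] <;> ring

theorem hessianCov_smul (c : ℂ) (j : Fin 4 → ℂ) : hessianCov (c • j) = c ^ 2 • hessianCov j := by
  funext k
  fin_cases k <;> simp [hessianCov] <;> ring

theorem linCov_smul (c e : ℂ) (i : Fin 3 → ℂ) (j : Fin 4 → ℂ) :
    linCov (c • i) (e • j) = (c * e) • linCov i j := by
  funext k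
  fin_cases k <;> simp [linCov] <;> ring

theorem jacCov_smul (c e : ℂ) (i h : Fin 3 → ℂ) :
    jacCov (c • i) (e • h) = (c * e) • jacCov i h := by
  funext k
  fin_cases k <;> simp [jacCov] <;> ring

theorem basePoly_isHomogeneous (k : Fin 3) : (basePoly k).IsHomogeneous (4 * baseWeight k) := by
  refine isHomogeneous_of_eval_two_smul fun a => ?_
  rw [eval_basePoly, eval_basePoly, normCoeff_smul]
  simp only [baseInv, quadCov_smul, cubicCov_smul, hessianCov_smul]
  generalize quadCov (normCoeff a) = i
  generalize hessianCov (cubicCov (normCoeff a)) = h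
  generalize cubicCov (normCoeff a) = j
  fin_cases k <;> simp [baseWeight, quadDisc, quadPairing, cubicDisc] <;> ring

theorem skewPoly_isHomogeneous : skewPoly.IsHomogeneous 18 := by
  refine isHomogeneous_of_eval_two_smul fun a => ?_
  rw [eval_skewPoly, eval_skewPoly, normCoeff_smul]
  simp only [skewInv, quadCov_smul, cubicCov_smul, hessianCov_smul, linCov_smul, jacCov_smul]
  generalize jacCov (quadCov (normCoeff a)) (hessianCov (cubicCov (normCoeff a))) = h
  generalize linCov (quadCov (normCoeff a)) (cubicCov (normCoeff a)) = l
  simp [quadAtRoot]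
  ring

theorem eval_smul_basePoly (c : ℂ) (a : Fin (5+1) → ℂ) (k : Fin 3) :
    eval (c • a) (basePoly k) = (c ^ 4) ^ baseWeight k * eval a (basePoly k) := by
  rw [eval_smul_of_isHomogeneous (basePoly_isHomogeneous k), pow_mul]

theorem exists_eval_basePoly (x : Fin 3 → ℂ) : ∃ a, (fun k => eval a (basePoly k)) = x := by
  by_cases hx : x 2 = 0
  · obtain ⟨s, hs⟩ := IsAlgClosed.exists_pow_nat_eq (x 0) (n := 2) two_pos
    obtain ⟨t, ht⟩ := IsAlgClosed.exists_pow_nat_eq (-x 1 / 2) (n := 5) (by norm_num)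
    refine ⟨ofNormCoeff ![s, t, 0, 0, 0, 1], ?_⟩
    funext k
    rw [eval_basePoly_degenerate]
    fin_cases k
    · exact hs
    · simp [ht]
      ring
    · exact hx.symm
  · obtain ⟨e, he⟩ := IsAlgClosed.exists_pow_nat_eq (x 2) (n := 4) (by norm_num)
    have he0 : e ≠ 0 := by
      rintro rfl
      exact hx (by simpa using he.symm)
    obtain ⟨u, v, w, h1, h2, h3⟩ := exists_roots_cubic (((x 1 / e ^ 2) ^ 2 - x 0) / (4 * e))
      (x 1 / e ^ 2) e
    refine ⟨sylvester u v w, ?_⟩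
    funext k
    rw [eval_basePoly_sylvester, h1, h2, h3]
    fin_cases k
    · simp
      field_simp
      ring
    · simp
      field_simp
    · exact he

theorem algebraicIndependent_basePoly : AlgebraicIndependent ℂ basePoly := by
  rw [algebraicIndependent_iff]
  intro Q hQ
  refine MvPolynomial.funext fun x => ?_
  obtain ⟨a, rfl⟩ := exists_eval_basePoly x
  rw [← eval_aeval_basePoly, hQ, map_zero, map_zero]

/-- The polynomial expressing the square of the skew invariant through the basic invariants. -/
def skewSq : MvPolynomial (Fin 3) ℂ :=
  C (9 / 16) * (X 0 * X 1 ^ 4 + 8 * X 1 ^ 3 * X 2 - 2 * X 0 ^ 2 * X 1 ^ 2 * X 2 -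
    72 * X 0 * X 1 * X 2 ^ 2 - 432 * X 2 ^ 3 + X 0 ^ 3 * X 2 ^ 2)

theorem eval_skewSq (x : Fin 3 → ℂ) : eval x skewSq = 9 / 16 * (x 0 * x 1 ^ 4 +
    8 * x 1 ^ 3 * x 2 - 2 * x 0 ^ 2 * x 1 ^ 2 * x 2 - 72 * x 0 * x 1 * x 2 ^ 2 - 432 * x 2 ^ 3 +
    x 0 ^ 3 * x 2 ^ 2) := by
  simp [skewSq]

theorem skewPoly_sq_eq : skewPoly ^ 2 = aeval basePoly skewSq := by
  refine MvPolynomial.funext fun a => ?_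
  have h := congrArg (eval a) skewPoly_sq
  rw [eval_aeval_basePoly, eval_skewSq]
  simp at h ⊢
  linear_combination (1 / 16) * h

theorem skewPoly_ne_zero : skewPoly ≠ 0 := by
  intro h
  exact skewPoly_degenerate_ne_zero one_ne_zero one_ne_zero (by rw [h, map_zero])

theorem skewSq_isWeightedHomogeneous : skewSq.IsWeightedHomogeneous baseWeight 9 := by
  refine isWeightedHomogeneous_of_eval_two fun x => ?_
  rw [eval_skewSq, eval_skewSq]
  simp [baseWeight]
  ring

theorem isWeightedHomogeneous_of_mul {P G : MvPolynomial (Fin (5+1)) ℂ} {Q : MvPolynomial (Fin 3) ℂ}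
    {m e : ℕ} (hG : G.IsHomogeneous m) (hG0 : G ≠ 0) (hPQ : P = G * aeval basePoly Q)
    (hP : P.IsHomogeneous (m + 4 * e)) : Q.IsWeightedHomogeneous baseWeight e := by
  obtain ⟨c, hc⟩ := IsAlgClosed.exists_pow_nat_eq (2 : ℂ) (n := 4) (by norm_num)
  have hc0 : c ≠ 0 := by
    rintro rfl
    norm_num at hc
  have key : aeval basePoly (aeval (fun k => (C (2 ^ baseWeight k) * X k :
      MvPolynomial (Fin 3) ℂ)) Q) = aeval basePoly (C (2 ^ e) * Q) := by
    refine mul_left_cancel₀ hG0 (MvPolynomial.funext fun a => ?_)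
    have h := eval_smul_of_isHomogeneous hP c a
    rw [hPQ, map_mul, map_mul, eval_smul_of_isHomogeneous hG, pow_add, mul_assoc, mul_assoc] at h
    have h2 := mul_left_cancel₀ (pow_ne_zero m hc0) h
    rw [eval_aeval_basePoly] at h2
    rw [map_mul, map_mul, eval_aeval_basePoly, eval_aeval]
    simp only [eval_smul_basePoly, hc] at h2
    simp only [map_mul, eval_C, eval_X]
    rw [h2, pow_mul, hc, aeval_C, algebraMap_eq, eval_C]
    ring
  have h3 := algebraicIndependent_iff_injective_aeval.mp algebraicIndependent_basePoly key
  refine isWeightedHomogeneous_of_eval_two fun x => ?_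
  have h4 := congrArg (eval x) h3
  rw [eval_aeval] at h4
  simpa using h4

/-- Structure of the invariant ring of the binary quintic. -/
theorem invariant_cases {P : MvPolynomial (Fin (5+1)) ℂ} (hP : P ∈ invariantRing 5) (hP0 : P ≠ 0)
    {d : ℕ} (hd : P.IsHomogeneous d) :
    (∃ (e : ℕ) (Q : MvPolynomial (Fin 3) ℂ), d = 4 * e ∧
      Q.IsWeightedHomogeneous baseWeight e ∧ P = aeval basePoly Q) ∨
    (∃ (e : ℕ) (Q : MvPolynomial (Fin 3) ℂ), d = 18 + 4 * e ∧
      Q.IsWeightedHomogeneous baseWeight e ∧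
      P = skewPoly * aeval basePoly Q) := by
  by_cases h2 : Odd d
  · exact absurd (eq_zero_of_odd hP hd h2) hP0
  rw [Nat.not_odd_iff] at h2
  by_cases h4 : 4 ∣ d
  · obtain ⟨e, rfl⟩ := h4
    obtain ⟨Q, hQ⟩ := exists_eq_aeval_of_four_dvd hP hd (dvd_mul_right 4 e)
    refine Or.inl ⟨e, Q, rfl, ?_, hQ⟩
    exact isWeightedHomogeneous_of_mul (G := 1) (m := 0) (isHomogeneous_one _ _) one_ne_zero
      (hQ.trans (one_mul _).symm) (by rwa [zero_add])
  · obtain ⟨Q, hQ⟩ := exists_eq_skewPoly_mul_aeval hP hd (by omega)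
    have hle : 18 ≤ d := by
      have hQ0 : aeval basePoly Q ≠ 0 := by
        intro h
        rw [h, mul_zero] at hQ
        exact hP0 hQ
      have h := totalDegree_mul_of_isDomain skewPoly_ne_zero hQ0
      rw [← hQ, hd.totalDegree hP0, skewPoly_isHomogeneous.totalDegree skewPoly_ne_zero] at h
      omega
    obtain ⟨e, rfl⟩ : ∃ e, d = 18 + 4 * e := ⟨(d - 18) / 4, by omega⟩
    exact Or.inr ⟨e, Q, rfl, isWeightedHomogeneous_of_mul skewPoly_isHomogeneous skewPoly_ne_zero
      hQ hd, hQ⟩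

/-- If an hsop vanishes at `a`, then so does every homogeneous invariant of positive degree. -/
theorem IsHSOP.eval_eq_zero {m : ℕ} {d : Fin (m-2) → ℕ} {p : Fin (m-2) → invariantRing m}
    (h : IsHSOP m d p) {a : Fin (m+1) → ℂ}
    (ha : ∀ k, eval a (p k : MvPolynomial (Fin (m+1)) ℂ) = 0) (T : invariantRing m) {n : ℕ}
    (hT : (T : MvPolynomial (Fin (m+1)) ℂ).IsHomogeneous n) (hn : 0 < n) :
    eval a (T : MvPolynomial (Fin (m+1)) ℂ) = 0 := by
  obtain ⟨hd, hp, -, hfin⟩ := h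
  by_contra hTa
  let φ (c : ℂ) : invariantRing m →ₐ[ℂ] ℂ := (aeval (c • a)).comp (invariantRing m).val
  have hφ (c : ℂ) {P : invariantRing m} {e : ℕ}
      (hP : (P : MvPolynomial (Fin (m+1)) ℂ).IsHomogeneous e) :
      φ c P = c ^ e * eval a (P : MvPolynomial (Fin (m+1)) ℂ) := by
    rw [← eval_smul_of_isHomogeneous hP]
    rfl
  have hS (c : ℂ) : Algebra.adjoin ℂ (Set.range p) ≤ AlgHom.equalizer (φ c) (φ 0) := by
    refine AlgHom.adjoin_le_equalizer _ _ ?_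
    rintro _ ⟨k, rfl⟩
    rw [hφ c (hp k), hφ 0 (hp k), ha, mul_zero, mul_zero]
  have hint := Algebra.IsIntegral.of_finite (Algebra.adjoin ℂ (Set.range p)) (invariantRing m)
  obtain ⟨g, hg, hgT⟩ := hint.isIntegral T
  let ψ : Algebra.adjoin ℂ (Set.range p) →+* ℂ :=
    (φ 0 : invariantRing m →+* ℂ).comp (algebraMap _ (invariantRing m))
  have hroot (c : ℂ) : (g.map ψ).eval (φ c T) = 0 := by
    have h1 := congrArg (φ c : invariantRing m →+* ℂ) hgT
    rw [Polynomial.hom_eval₂, map_zero] at h1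
    rw [Polynomial.eval_map]
    have hψ : ψ = (φ c : invariantRing m →+* ℂ).comp (algebraMap _ (invariantRing m)) :=
      RingHom.ext fun s => (hS c s.2).symm
    rw [hψ]
    exact h1
  have hzero : g.map ψ = 0 := by
    refine Polynomial.funext fun z => ?_
    obtain ⟨c, hc⟩ := IsAlgClosed.exists_pow_nat_eq
      (z / eval a (T : MvPolynomial (Fin (m+1)) ℂ)) hn
    have h1 := hroot c
    rw [hφ c hT, hc, div_mul_cancel₀ _ hTa] at h1
    rw [h1, Polynomial.eval_zero]
  exact (hg.map ψ).ne_zero hzero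

/-- `IsSquareOfInvariant d R` says that `R`, evaluated at the basic invariants, is the square of
a homogeneous invariant of degree `d`. -/
def IsSquareOfInvariant (d : ℕ) (R : MvPolynomial (Fin 3) ℂ) : Prop :=
  (∃ (e : ℕ) (Q : MvPolynomial (Fin 3) ℂ), d = 4 * e ∧
    Q.IsWeightedHomogeneous baseWeight e ∧ R = Q ^ 2) ∨
  (∃ (e : ℕ) (Q : MvPolynomial (Fin 3) ℂ), d = 18 + 4 * e ∧
    Q.IsWeightedHomogeneous baseWeight e ∧ R = skewSq * Q ^ 2)

theorem IsHSOP.exists_squares {d : Fin 3 → ℕ} {p : Fin (5-2) → invariantRing 5}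
    (h : IsHSOP 5 d p) : ∃ R : Fin 3 → MvPolynomial (Fin 3) ℂ,
      (∀ k, IsSquareOfInvariant (d k) (R k)) ∧ ∀ x, (∀ k, eval x (R k) = 0) → x = 0 := by
  have hex (k : Fin 3) : ∃ R, IsSquareOfInvariant (d k) R ∧
      (p k : MvPolynomial (Fin (5+1)) ℂ) ^ 2 = aeval basePoly R := by
    have hne : (p k : MvPolynomial (Fin (5+1)) ℂ) ≠ 0 := fun h0 =>
      h.2.2.1.ne_zero k (Subtype.ext h0)
    rcases invariant_cases (p k).2 hne (h.2.1 k) with ⟨e, Q, h1, h2, h3⟩ | ⟨e, Q, h1, h2, h3⟩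
    · exact ⟨Q ^ 2, Or.inl ⟨e, Q, h1, h2, rfl⟩, by rw [h3, map_pow]⟩
    · exact ⟨skewSq * Q ^ 2, Or.inr ⟨e, Q, h1, h2, rfl⟩,
        by rw [h3, mul_pow, skewPoly_sq_eq, map_mul, map_pow]⟩
  choose R hR hpR using hex
  refine ⟨R, hR, fun x hx => ?_⟩
  obtain ⟨a, rfl⟩ := exists_eval_basePoly x
  have ha (k : Fin 3) : eval a (p k : MvPolynomial (Fin (5+1)) ℂ) = 0 := by
    have h1 := congrArg (eval a) (hpR k)
    rw [eval_aeval_basePoly, hx k, map_pow] at h1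
    exact pow_eq_zero_iff two_ne_zero |>.mp h1
  funext k
  exact h.eval_eq_zero ha ⟨basePoly k, basePoly_mem k⟩ (basePoly_isHomogeneous k)
    (by simp [baseWeight])

theorem IsSquareOfInvariant.isWeightedHomogeneous {d : ℕ} {R : MvPolynomial (Fin 3) ℂ}
    (h : IsSquareOfInvariant d R) : ∃ n, d = 2 * n ∧ R.IsWeightedHomogeneous baseWeight n := by
  rcases h with ⟨e, Q, rfl, hQ, rfl⟩ | ⟨e, Q, rfl, hQ, rfl⟩
  · exact ⟨2 * e, by ring, hQ.pow 2⟩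
  · exact ⟨9 + 2 * e, by ring, skewSq_isWeightedHomogeneous.mul (hQ.pow 2)⟩

theorem dvd_of_eval_ne_zero {σ : Type*} {w : σ → ℕ} {e m : ℕ} {Q : MvPolynomial σ ℂ}
    (hQ : Q.IsWeightedHomogeneous w e) {c : ℂ} (hc : IsPrimitiveRoot c m) {x : σ → ℂ}
    (hx : ∀ i, c ^ w i * x i = x i) (h : eval x Q ≠ 0) : m ∣ e := by
  have h1 := eval_weighted_smul hQ c x
  simp only [hx] at h1
  exact (hc.pow_eq_one_iff_dvd e).mp (mul_right_cancel₀ h (by rw [one_mul, ← h1]))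

theorem eval_eq_zero_of_weight_one {Q : MvPolynomial (Fin 3) ℂ}
    (hQ : Q.IsWeightedHomogeneous baseWeight 1) {x : Fin 3 → ℂ} (hx : x 0 = 0) :
    eval x Q = 0 := by
  rw [eval_eq]
  refine Finset.sum_eq_zero fun m hm => ?_
  have h1 := hQ (mem_support_iff.mp hm)
  rw [Finsupp.weight_apply, Finsupp.sum_fintype _ _ (by simp), Fin.sum_univ_three] at h1
  simp [baseWeight] at h1
  have h0 : m 0 = 1 := by omega
  rw [Finset.prod_eq_zero (i := 0) (by simp [h0]) (by simp [h0, hx]), mul_zero]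

/-- A quasi-homogeneous polynomial of positive degree in two variables has a nontrivial zero. -/
theorem exists_ne_zero_eval_eq_zero {q : MvPolynomial (Fin 2) ℂ} {w : Fin 2 → ℕ} {n : ℕ}
    (hq : ∀ z, eval (fun i => 2 ^ w i * z i) q = 2 ^ n * eval z q) (hn : 0 < n) :
    ∃ z ≠ 0, eval z q = 0 := by
  by_contra! h
  have hconst (v : Fin 2 → Polynomial ℂ) (hv : ∀ t, (fun i => (v i).eval t) ≠ 0) :
      ∃ α, ∀ t, eval (fun i => (v i).eval t) q = α := by
    have hev (t : ℂ) : (aeval v q).eval t = eval (fun i => (v i).eval t) q := by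
      rw [← Polynomial.coe_evalRingHom, map_aeval, eval]
      congr 2
      ext z
      simp
    have hdeg : (aeval v q).degree = 0 := by
      by_contra hdeg
      obtain ⟨t, ht⟩ := IsAlgClosed.exists_root _ hdeg
      exact h _ (hv t) (by rw [← hev]; exact ht)
    rw [Polynomial.eq_C_of_degree_eq_zero hdeg] at hev
    exact ⟨_, fun t => by rw [← hev, Polynomial.eval_C]⟩
  obtain ⟨α, hα⟩ := hconst ![1, Polynomial.X] fun t ht => by simpa using congrFun ht 0
  obtain ⟨β, hβ⟩ := hconst ![Polynomial.X, 1] fun t ht => by simpa using congrFun ht 1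
  have h1 (t : ℂ) : eval ![1, t] q = α := by
    rw [← hα t]
    congr 2
    funext i
    fin_cases i <;> simp
  have h2 (t : ℂ) : eval ![t, 1] q = β := by
    rw [← hβ t]
    congr 2
    funext i
    fin_cases i <;> simp
  have hαβ : α = β := by rw [← h1 1, h2 1]
  have hα0 : α ≠ 0 := by
    rw [← h1 1]
    exact h _ fun h0 => by simpa using congrFun h0 0
  have h3 := hq ![(2 ^ w 0)⁻¹, 1]
  rw [h2, ← hαβ, ← h1 (2 ^ w 1)] at h3
  have h4 : (fun i => 2 ^ w i * ![((2 : ℂ) ^ w 0)⁻¹, 1] i) = ![1, 2 ^ w 1] := by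
    funext i
    fin_cases i <;> simp
  rw [h4, h1] at h3
  have h5 : (1 : ℂ) = 2 ^ n := mul_right_cancel₀ hα0 (by rw [one_mul]; exact h3)
  have h6 : (1 : ℕ) = 2 ^ n := by exact_mod_cast h5
  exact (Nat.one_lt_two_pow hn.ne').ne h6

theorem pair_le_map_univ_iff {ι α : Type*} [Fintype ι] [DecidableEq ι] {f : ι → α} {a b : α} :
    ({a, b} : Multiset α) ≤ Finset.univ.val.map f ↔ ∃ i j, i ≠ j ∧ f i = a ∧ f j = b := by
  have key (i : ι) : Finset.univ.val.map f = f i ::ₘ (Finset.univ.erase i).val.map f := by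
    rw [← Multiset.map_cons, Finset.erase_val, Multiset.cons_erase (Finset.mem_univ_val i)]
  rw [Multiset.insert_eq_cons]
  constructor
  · intro h
    obtain ⟨i, -, rfl⟩ := Multiset.mem_map.mp (Multiset.mem_of_le h (Multiset.mem_cons_self _ _))
    rw [key i, Multiset.cons_le_cons_iff, Multiset.singleton_le] at h
    obtain ⟨j, hj, rfl⟩ := Multiset.mem_map.mp h
    exact ⟨i, j, (Finset.ne_of_mem_erase hj).symm, rfl, rfl⟩
  · rintro ⟨i, j, hij, rfl, rfl⟩
    rw [key i, Multiset.cons_le_cons_iff, Multiset.singleton_le]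
    exact Multiset.mem_map_of_mem f (Finset.mem_erase.mpr ⟨hij.symm, Finset.mem_univ j⟩)

theorem two_le_card_filter_iff {P : Fin 3 → Prop} [DecidablePred P] :
    2 ≤ (Finset.univ.filter P).card ↔ ∀ i j, i ≠ j → P i ∨ P j := by
  rw [Finset.card_filter, Fin.sum_univ_three]
  constructor
  · intro h i j hij
    fin_cases i <;> fin_cases j <;> simp at hij ⊢ <;> split_ifs at h <;> simp_all
  · intro h
    have h01 := h 0 1 (by decide)
    have h02 := h 0 2 (by decide)
    have h12 := h 1 2 (by decide)
    split_ifs <;> simp_all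

/-- If two of three weighted homogeneous polynomials vanish along a quasi-homogeneous curve
family, then the three have a nontrivial common zero. -/
theorem exists_common_zero {d : Fin 3 → ℕ} (hd : ∀ k, 0 < d k)
    {R : Fin 3 → MvPolynomial (Fin 3) ℂ} (hR : ∀ k, IsSquareOfInvariant (d k) (R k))
    (v : Fin 3 → MvPolynomial (Fin 2) ℂ) (w : Fin 2 → ℕ) {s : ℕ} (hs : 0 < s)
    (hv : ∀ k z, eval (fun i => 2 ^ w i * z i) (v k) = (2 ^ s) ^ baseWeight k * eval z (v k))
    (hv0 : ∀ z, (∀ k, eval z (v k) = 0) → z = 0) {i j : Fin 3} (hij : i ≠ j)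
    (hi : ∀ z, eval (fun k => eval z (v k)) (R i) = 0)
    (hj : ∀ z, eval (fun k => eval z (v k)) (R j) = 0) :
    ∃ x ≠ 0, ∀ k, eval x (R k) = 0 := by
  obtain ⟨m, hm⟩ : ∃ m : Fin 3, ∀ k, k = i ∨ k = j ∨ k = m := by
    have h : ∀ i j : Fin 3, i ≠ j → ∃ m : Fin 3, ∀ k, k = i ∨ k = j ∨ k = m := by decide
    exact h i j hij
  obtain ⟨n, hdn, hn⟩ := (hR m).isWeightedHomogeneous
  obtain ⟨z, hz, hz0⟩ := exists_ne_zero_eval_eq_zero (q := aeval v (R m)) (w := w) (n := s * n)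
    (fun z => by
      rw [eval_aeval, eval_aeval, pow_mul, ← eval_weighted_smul hn]
      simp only [hv]) (Nat.mul_pos hs (by have := hd m; omega))
  refine ⟨fun k => eval z (v k), fun h => hz (hv0 z (congrFun h)), fun k => ?_⟩
  rcases hm k with rfl | rfl | rfl
  · exact hi z
  · exact hj z
  · rw [← eval_aeval]
    exact hz0

theorem IsSquareOfInvariant.eval_eq_zero_of_four_or {d : ℕ} {R : MvPolynomial (Fin 3) ℂ}
    (h : IsSquareOfInvariant d R) (hd : d = 4 ∨ d = 22) {x : Fin 3 → ℂ} (hx : x 0 = 0) :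
    eval x R = 0 := by
  rcases h with ⟨e, Q, rfl, hQ, rfl⟩ | ⟨e, Q, rfl, hQ, rfl⟩
  · obtain rfl : e = 1 := by omega
    simp [eval_eq_zero_of_weight_one hQ hx]
  · obtain rfl : e = 1 := by omega
    simp [eval_eq_zero_of_weight_one hQ hx]

theorem IsSquareOfInvariant.eval_eq_zero_of_not_four_dvd {d : ℕ} {R : MvPolynomial (Fin 3) ℂ}
    (h : IsSquareOfInvariant d R) (hd : ¬ 4 ∣ d) {x : Fin 3 → ℂ} (hx : eval x skewSq = 0) :
    eval x R = 0 := by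
  rcases h with ⟨e, Q, rfl, hQ, rfl⟩ | ⟨e, Q, rfl, hQ, rfl⟩
  · exact absurd (dvd_mul_right 4 e) hd
  · rw [map_mul, hx, zero_mul]

theorem necessary_conditions {d : Fin 3 → ℕ} (hd : ∀ k, 0 < d k)
    {R : Fin 3 → MvPolynomial (Fin 3) ℂ} (hR : ∀ k, IsSquareOfInvariant (d k) (R k))
    (h0 : ∀ x, (∀ k, eval x (R k) = 0) → x = 0) :
    (∀ k, 2 ∣ d k) ∧ (∀ k, d k ∉ ({2, 6, 10, 14} : Set ℕ)) ∧
      (∀ i j, i ≠ j → ¬ (d i = 4 ∧ (d j = 4 ∨ d j = 22))) ∧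
      (∀ i j, i ≠ j → 4 ∣ d i ∨ 4 ∣ d j) ∧ (∃ k, 6 ∣ d k) ∧ (∃ k, 8 ∣ d k) := by
  have hdeg (k : Fin 3) : ∃ e, d k = 4 * e ∨ d k = 18 + 4 * e := by
    rcases hR k with ⟨e, -, h, -⟩ | ⟨e, -, h, -⟩
    · exact ⟨e, Or.inl h⟩
    · exact ⟨e, Or.inr h⟩
  have hex (x : Fin 3 → ℂ) (hx : x ≠ 0) : ∃ k, eval x (R k) ≠ 0 := by
    by_contra! h
    exact hx (h0 x h)
  refine ⟨fun k => ?_, fun k => ?_, fun i j hij h => ?_, fun i j hij => ?_, ?_, ?_⟩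
  · obtain ⟨e, h⟩ := hdeg k
    omega
  · obtain ⟨e, h⟩ := hdeg k
    simp only [Set.mem_insert_iff, Set.mem_singleton_iff]
    omega
  · obtain ⟨x, hx, hxR⟩ := exists_common_zero hd hR ![0, X 0, X 1] ![2, 3] one_pos
      (fun k z => by fin_cases k <;> simp [baseWeight])
      (fun z hz => by
        funext i
        fin_cases i
        · simpa using hz 1
        · simpa using hz 2) hij
      (fun z => (hR i).eval_eq_zero_of_four_or (Or.inl h.1) (by simp))
      (fun z => (hR j).eval_eq_zero_of_four_or h.2 (by simp))
    exact hx (h0 x hxR)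
  · by_contra! h
    have hF (z : Fin 2 → ℂ) : eval (fun k => eval z ((![X 0 * (X 0 ^ 2 - 4 * X 1),
        X 1 ^ 2 * (X 0 ^ 2 + 2 * X 1), X 0 * X 1 ^ 4] : Fin 3 → MvPolynomial (Fin 2) ℂ) k))
        skewSq = 0 := by
      rw [eval_skewSq]
      simp
      ring
    obtain ⟨x, hx, hxR⟩ := exists_common_zero hd hR ![X 0 * (X 0 ^ 2 - 4 * X 1),
        X 1 ^ 2 * (X 0 ^ 2 + 2 * X 1), X 0 * X 1 ^ 4] ![1, 2] three_pos
      (fun k z => by fin_cases k <;> simp [baseWeight] <;> ring)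
      (fun z hz => by
        have h1 := hz 0
        have h2 := hz 1
        have h3 := hz 2
        simp at h1 h2 h3
        funext i
        fin_cases i <;> simp <;> grind) hij
      (fun z => (hR i).eval_eq_zero_of_not_four_dvd h.1 (hF z))
      (fun z => (hR j).eval_eq_zero_of_not_four_dvd h.2 (hF z))
    exact hx (h0 x hxR)
  · obtain ⟨k, hk⟩ := hex ![0, 0, 1] fun h => by simpa using congrFun h 2
    have hω := Complex.isPrimitiveRoot_exp 3 three_ne_zero
    have hfix (i : Fin 3) : Complex.exp (2 * Real.pi * Complex.I / (3 : ℕ)) ^ baseWeight i *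
        (![0, 0, 1] : Fin 3 → ℂ) i = (![0, 0, 1] : Fin 3 → ℂ) i := by
      fin_cases i
      · simp
      · simp
      · simpa [baseWeight] using hω.pow_eq_one
    refine ⟨k, ?_⟩
    rcases hR k with ⟨e, Q, h, hQ, hRQ⟩ | ⟨e, Q, h, hQ, hRQ⟩
    · have := dvd_of_eval_ne_zero hQ hω hfix fun h => hk (by simp [hRQ, h])
      omega
    · have := dvd_of_eval_ne_zero hQ hω hfix fun h => hk (by simp [hRQ, h])
      omega
  · obtain ⟨k, hk⟩ := hex ![0, 1, 0] fun h => by simpa using congrFun h 1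
    refine ⟨k, ?_⟩
    rcases hR k with ⟨e, Q, h, hQ, hRQ⟩ | ⟨e, Q, h, hQ, hRQ⟩
    · have := dvd_of_eval_ne_zero hQ (IsPrimitiveRoot.neg_one 0 two_ne_zero.symm)
        (x := ![0, 1, 0]) (fun i => by fin_cases i <;> simp [baseWeight]) fun h => hk (by simp [hRQ, h])
      omega
    · exact absurd (by simp [hRQ, eval_skewSq]) hk

/-- Weighted homogeneous polynomials without nontrivial common zero generate a subalgebra over
which the polynomial ring is finite. -/
theorem finite_adjoin_of_common_zero {σ ι : Type*} [Finite σ] [Finite ι] {w : σ → ℕ} {n : ι → ℕ}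
    {R : ι → MvPolynomial σ ℂ} (hR : ∀ k, (R k).IsWeightedHomogeneous w (n k))
    (hn : ∀ k, 0 < n k) (h0 : ∀ x, (∀ k, eval x (R k) = 0) → x = 0) :
    Module.Finite (Algebra.adjoin ℂ (Set.range R)) (MvPolynomial σ ℂ) := by
  classical
  have := Fintype.ofFinite ι
  have hX (i : σ) : ∃ N, X i ^ N ∈ Ideal.span (Set.range R) := by
    change X i ∈ (Ideal.span (Set.range R)).radical
    rw [← vanishingIdeal_zeroLocus_eq_radical (K := ℂ)]
    intro x hx
    rw [h0 x fun k => by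
      simpa [aeval_eq_eval] using hx (R k) (Ideal.subset_span (Set.mem_range_self k))]
    simp
  choose N hN using hX
  let T : Set (σ →₀ ℕ) := {u | ∀ i, u i < N i}
  have hT : T.Finite := (Set.finite_Icc 0 (Finsupp.equivFunOnFinite.symm N)).subset
    fun u hu => ⟨zero_le, fun i => (hu i).le⟩
  let M := Submodule.span (Algebra.adjoin ℂ (Set.range R))
    ((fun u => (monomial u 1 : MvPolynomial σ ℂ)) '' T)
  have key (m : ℕ) : ∀ u, Finsupp.weight w u = m → monomial u 1 ∈ M := by
    induction m using Nat.strong_induction_on with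
    | _ m ih =>
    intro u hu
    by_cases huT : u ∈ T
    · exact Submodule.subset_span (Set.mem_image_of_mem _ huT)
    obtain ⟨i, hi⟩ : ∃ i, N i ≤ u i := by simpa [T] using huT
    have hmem : monomial u (1 : ℂ) ∈ Ideal.span (Set.range R) := by
      have h1 : monomial u (1 : ℂ) = monomial (u - Finsupp.single i (N i)) 1 * X i ^ N i := by
        rw [X_pow_eq_monomial, monomial_mul, one_mul,
          tsub_add_cancel_of_le (Finsupp.single_le_iff.mpr hi)]
      rw [h1]
      exact Ideal.mul_mem_left _ _ (hN i)
    obtain ⟨g, hg⟩ := Ideal.mem_span_range_iff_exists_fun.mp hmem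
    have hcomp (k : ι) (f : MvPolynomial σ ℂ) :
        weightedHomogeneousComponent w m (f * R k) ∈ M := by
      induction f using MvPolynomial.induction_on' with
      | monomial v a =>
        rw [weightedHomogeneousComponent_of_mem
          ((isWeightedHomogeneous_monomial w v a rfl).mul (hR k))]
        split_ifs with hm
        · have h1 : monomial v a * R k =
              (⟨a • R k, Subalgebra.smul_mem _ (Algebra.subset_adjoin (Set.mem_range_self k)) a⟩ :
                Algebra.adjoin ℂ (Set.range R)) • (monomial v 1 : MvPolynomial σ ℂ) := by
            rw [Subalgebra.smul_def, smul_eq_mul, smul_mul_assoc, ← mul_smul_comm, smul_monomial,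
              smul_eq_mul, mul_one, mul_comm]
          rw [h1]
          exact M.smul_mem _ (ih _ (by have := hn k; omega) v rfl)
        · exact M.zero_mem
      | add p q hp hq =>
        rw [add_mul, map_add]
        exact M.add_mem hp hq
    rw [← (isWeightedHomogeneous_monomial w u (1 : ℂ) hu).weightedHomogeneousComponent_same, ← hg,
      map_sum]
    exact M.sum_mem fun k _ => hcomp k (g k)
  refine ⟨Submodule.fg_def.mpr ⟨(fun u => monomial u 1) '' T, hT.image _,
    eq_top_iff.mpr fun f _ => ?_⟩⟩
  induction f using MvPolynomial.induction_on' with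
  | monomial v a =>
    have h1 : monomial v a = algebraMap ℂ (Algebra.adjoin ℂ (Set.range R)) a •
        (monomial v 1 : MvPolynomial σ ℂ) := by
      rw [algebraMap_smul, smul_monomial, smul_eq_mul, mul_one]
    rw [h1]
    exact M.smul_mem _ (key _ v rfl)
  | add p q hp hq => exact Submodule.add_mem _ (hp trivial) (hq trivial)

theorem sl2Act_smul (g : Matrix.SpecialLinearGroup (Fin 2) ℂ) (c : ℂ) (a : Fin (5+1) → ℂ) :
    sl2Act 5 g (c • a) = c • sl2Act 5 g a := by
  refine quinticVal_injective fun x y => ?_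
  rw [quinticVal_smul, quinticVal_sl2Act, quinticVal_sl2Act, quinticVal_smul]

theorem exists_polynomial_eval_smul {σ : Type*} (P : MvPolynomial σ ℂ) (b : σ → ℂ) :
    ∃ f : Polynomial ℂ, (∀ c, f.eval c = eval (c • b) P) ∧
      ∀ n ≤ P.totalDegree, f.coeff n = eval b (homogeneousComponent n P) := by
  refine ⟨∑ i ∈ Finset.range (P.totalDegree + 1),
    Polynomial.C (eval b (homogeneousComponent i P)) * Polynomial.X ^ i, fun c => ?_, fun n hn => ?_⟩
  · conv_rhs => rw [← sum_homogeneousComponent P]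
    simp only [Polynomial.eval_finsetSum, map_sum, Polynomial.eval_mul, Polynomial.eval_C,
      Polynomial.eval_pow, Polynomial.eval_X,
      eval_smul_of_isHomogeneous (homogeneousComponent_isHomogeneous _ P)]
    exact Finset.sum_congr rfl fun i _ => mul_comm _ _
  · simp only [Polynomial.finsetSum_coeff, Polynomial.coeff_C_mul_X_pow]
    rw [Finset.sum_ite_eq, if_pos (Finset.mem_range.mpr (by omega))]

theorem homogeneousComponent_mem_invariantRing {P : MvPolynomial (Fin (5+1)) ℂ}
    (hP : P ∈ invariantRing 5) (n : ℕ) : homogeneousComponent n P ∈ invariantRing 5 := by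
  rcases lt_or_ge P.totalDegree n with hn | hn
  · rw [homogeneousComponent_eq_zero n P hn]
    exact zero_mem _
  intro g a
  obtain ⟨f₁, h₁, h₁'⟩ := exists_polynomial_eval_smul P a
  obtain ⟨f₂, h₂, h₂'⟩ := exists_polynomial_eval_smul P (sl2Act 5 g a)
  have h : f₁ = f₂ := Polynomial.funext fun c => by rw [h₁, h₂, ← sl2Act_smul, hP]
  rw [← h₁' n hn, ← h₂' n hn, h]

/-- The algebra map from the polynomial ring in the basic invariants to the ring of invariants. -/
def baseHom : MvPolynomial (Fin 3) ℂ →ₐ[ℂ] invariantRing 5 :=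
  aeval fun k => ⟨basePoly k, basePoly_mem k⟩

theorem coe_baseHom (Q : MvPolynomial (Fin 3) ℂ) :
    (baseHom Q : MvPolynomial (Fin (5+1)) ℂ) = aeval basePoly Q := by
  have h : (invariantRing 5).val.comp baseHom = aeval basePoly := by
    ext k
    simp [baseHom]
  exact DFunLike.congr_fun h Q

theorem exists_eq_add_skewPoly_mul (P : invariantRing 5) : ∃ Q₁ Q₂ : MvPolynomial (Fin 3) ℂ,
    P = baseHom Q₁ + baseHom Q₂ * ⟨skewPoly, skewPoly_mem⟩ := by
  have key (n : ℕ) : ∃ Q₁ Q₂ : MvPolynomial (Fin 3) ℂ,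
      homogeneousComponent n (P : MvPolynomial (Fin (5+1)) ℂ) =
        aeval basePoly Q₁ + aeval basePoly Q₂ * skewPoly := by
    by_cases h0 : homogeneousComponent n (P : MvPolynomial (Fin (5+1)) ℂ) = 0
    · exact ⟨0, 0, by simp [h0]⟩
    rcases invariant_cases (homogeneousComponent_mem_invariantRing P.2 n) h0
      (homogeneousComponent_isHomogeneous n _) with ⟨e, Q, -, -, h⟩ | ⟨e, Q, -, -, h⟩
    · exact ⟨Q, 0, by simp [h]⟩
    · exact ⟨0, Q, by simp [h, mul_comm]⟩
  choose Q₁ Q₂ hQ using key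
  refine ⟨∑ n ∈ Finset.range ((P : MvPolynomial (Fin (5+1)) ℂ).totalDegree + 1), Q₁ n,
    ∑ n ∈ Finset.range ((P : MvPolynomial (Fin (5+1)) ℂ).totalDegree + 1), Q₂ n,
    Subtype.ext ?_⟩
  push_cast
  rw [coe_baseHom, coe_baseHom, map_sum, map_sum, Finset.sum_mul, ← Finset.sum_add_distrib]
  simp_rw [← hQ]
  exact (sum_homogeneousComponent _).symm

theorem finite_baseHom : (baseHom : MvPolynomial (Fin 3) ℂ →+* invariantRing 5).Finite := by
  let := (baseHom : MvPolynomial (Fin 3) ℂ →+* invariantRing 5).toAlgebra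
  refine ⟨Submodule.fg_def.mpr ⟨{1, ⟨skewPoly, skewPoly_mem⟩}, by simp,
    eq_top_iff.mpr fun P _ => ?_⟩⟩
  obtain ⟨Q₁, Q₂, h⟩ := exists_eq_add_skewPoly_mul P
  refine Submodule.mem_span_pair.mpr ⟨Q₁, Q₂, ?_⟩
  rw [Algebra.smul_def, Algebra.smul_def, mul_one]
  exact h.symm

theorem three_le_trdeg : 3 ≤ Algebra.trdeg ℂ (invariantRing 5) := by
  have h : AlgebraicIndependent ℂ
      (fun k => (⟨basePoly k, basePoly_mem k⟩ : invariantRing 5)) := by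
    rw [algebraicIndependent_iff_injective_aeval]
    intro Q₁ Q₂ h
    refine algebraicIndependent_iff_injective_aeval.mp algebraicIndependent_basePoly ?_
    rw [← coe_baseHom, ← coe_baseHom]
    exact congrArg Subtype.val h
  simpa using h.cardinalMk_le_trdeg

theorem finite_adjoin_of_pow_eq {k A B ι : Type*} [CommRing k] [CommRing A] [CommRing B]
    [Algebra k A] [Algebra k B] {θ : A →ₐ[k] B} (hθ : (θ : A →+* B).Finite) {R : ι → A} {p : ι → B}
    {n : ℕ} (h : ∀ i, p i ^ n = θ (R i))
    (hR : Module.Finite (Algebra.adjoin k (Set.range R)) A) :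
    Module.Finite (Algebra.adjoin k (Set.range p)) B := by
  have hle : Algebra.adjoin k (Set.range R) ≤ (Algebra.adjoin k (Set.range p)).comap θ := by
    refine Algebra.adjoin_le ?_
    rintro _ ⟨i, rfl⟩
    change θ (R i) ∈ Algebra.adjoin k (Set.range p)
    rw [← h]
    exact pow_mem (Algebra.subset_adjoin (Set.mem_range_self i)) n
  let φ : Algebra.adjoin k (Set.range R) →ₐ[k] Algebra.adjoin k (Set.range p) :=
    (θ.comp (Algebra.adjoin k (Set.range R)).val).codRestrict _ fun s => hle s.2
  have h1 : ((algebraMap (Algebra.adjoin k (Set.range p)) B).comp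
      (φ : Algebra.adjoin k (Set.range R) →+* Algebra.adjoin k (Set.range p))).Finite :=
    hθ.comp (RingHom.finite_algebraMap.mpr hR)
  exact RingHom.finite_algebraMap.mp (RingHom.Finite.of_comp_finite h1)

theorem exists_isHSOP {d : Fin 3 → ℕ} (hd : ∀ k, 0 < d k)
    {R : Fin 3 → MvPolynomial (Fin 3) ℂ} (hR : ∀ k, IsSquareOfInvariant (d k) (R k))
    (h0 : ∀ x, (∀ k, eval x (R k) = 0) → x = 0) :
    ∃ p : Fin (5-2) → invariantRing 5, IsHSOP 5 d p := by
  have hex (k : Fin 3) : ∃ P : invariantRing 5,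
      (P : MvPolynomial (Fin (5+1)) ℂ).IsHomogeneous (d k) ∧ P ^ 2 = baseHom (R k) := by
    have hom {Q : MvPolynomial (Fin 3) ℂ} {e : ℕ} (hQ : Q.IsWeightedHomogeneous baseWeight e) :
        (aeval basePoly Q).IsHomogeneous (4 * e) := by
      refine isHomogeneous_of_eval_two_smul fun a => ?_
      rw [eval_aeval_basePoly, eval_aeval_basePoly, pow_mul, ← eval_weighted_smul hQ]
      simp only [eval_smul_basePoly]
    rcases hR k with ⟨e, Q, h1, h2, h3⟩ | ⟨e, Q, h1, h2, h3⟩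
    · exact ⟨baseHom Q, by rw [coe_baseHom, h1]; exact hom h2, by rw [h3, map_pow]⟩
    · refine ⟨⟨skewPoly, skewPoly_mem⟩ * baseHom Q, ?_, ?_⟩
      · rw [h1]
        push_cast
        rw [coe_baseHom]
        exact skewPoly_isHomogeneous.mul (hom h2)
      · rw [h3, map_mul, map_pow, mul_pow]
        congr 1
        refine Subtype.ext ?_
        rw [coe_baseHom, ← skewPoly_sq_eq]
        rfl
  choose p hp hpR using hex
  choose n hdn hn using fun k => (hR k).isWeightedHomogeneous
  have hfinR := finite_adjoin_of_common_zero hn (fun k => by have := hd k; have := hdn k; omega) h0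
  have hfin := finite_adjoin_of_pow_eq finite_baseHom hpR hfinR
  refine ⟨p, hd, hp, ?_, hfin⟩
  have hint := Algebra.IsIntegral.of_finite (Algebra.adjoin ℂ (Set.range p)) (invariantRing 5)
  exact (Algebra.IsAlgebraic.isTranscendenceBasis_of_le_trdeg_of_finite ℂ p
    (by simpa using three_le_trdeg)).1

theorem isWeightedHomogeneous_X_baseWeight (k : Fin 3) :
    (X k : MvPolynomial (Fin 3) ℂ).IsWeightedHomogeneous baseWeight (baseWeight k) :=
  isWeightedHomogeneous_X ℂ baseWeight k

theorem isWeightedHomogeneous_quadratic :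
    (X 1 + X 0 ^ 2 : MvPolynomial (Fin 3) ℂ).IsWeightedHomogeneous baseWeight 2 := by
  refine isWeightedHomogeneous_of_eval_two fun x => ?_
  simp [baseWeight]
  ring

theorem isWeightedHomogeneous_sextic (c : ℂ) :
    (X 1 ^ 3 + X 2 ^ 2 + C c * X 0 ^ 6 : MvPolynomial (Fin 3) ℂ).IsWeightedHomogeneous
      baseWeight 6 := by
  refine isWeightedHomogeneous_of_eval_two fun x => ?_
  simp [baseWeight]
  ring

theorem exists_squares_of_three {d : Fin 3 → ℕ} {i j k : Fin 3} (hij : i ≠ j) (hik : i ≠ k)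
    (hjk : j ≠ k) {A B D : MvPolynomial (Fin 3) ℂ} (hA : IsSquareOfInvariant (d i) A)
    (hB : IsSquareOfInvariant (d j) B) (hD : IsSquareOfInvariant (d k) D)
    (h0 : ∀ x, eval x A = 0 → eval x B = 0 → eval x D = 0 → x 0 = 0 ∧ x 1 = 0 ∧ x 2 = 0) :
    ∃ R : Fin 3 → MvPolynomial (Fin 3) ℂ,
      (∀ k, IsSquareOfInvariant (d k) (R k)) ∧ ∀ x, (∀ k, eval x (R k) = 0) → x = 0 := by
  have hall : ∀ l, l = i ∨ l = j ∨ l = k := by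
    have h : ∀ i j k : Fin 3, i ≠ j → i ≠ k → j ≠ k → ∀ l, l = i ∨ l = j ∨ l = k := by decide
    exact h i j k hij hik hjk
  let R : Fin 3 → MvPolynomial (Fin 3) ℂ := fun l => if l = i then A else if l = j then B else D
  have hi : R i = A := if_pos rfl
  have hj : R j = B := (if_neg hij.symm).trans (if_pos rfl)
  have hk : R k = D := (if_neg hik.symm).trans (if_neg hjk.symm)
  refine ⟨R, fun l => ?_, fun x hx => ?_⟩
  · rcases hall l with rfl | rfl | rfl
    · rwa [hi]
    · rwa [hj]
    · rwa [hk]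
  · obtain ⟨h1, h2, h3⟩ := h0 x (hi ▸ hx i) (hj ▸ hx j) (hk ▸ hx k)
    funext l
    fin_cases l
    · exact h1
    · exact h2
    · exact h3

theorem exists_squares_of_four_dvd {d : Fin 3 → ℕ}
    (h44 : ∀ i j, i ≠ j → ¬ (d i = 4 ∧ d j = 4)) (h4 : ∀ k, 4 ∣ d k) (h6 : ∃ k, 6 ∣ d k)
    (h8 : ∃ k, 8 ∣ d k) :
    ∃ R : Fin 3 → MvPolynomial (Fin 3) ℂ,
      (∀ k, IsSquareOfInvariant (d k) (R k)) ∧ ∀ x, (∀ k, eval x (R k) = 0) → x = 0 := by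
  have hthird : ∀ i j : Fin 3, i ≠ j → ∃ k, i ≠ k ∧ j ≠ k := by decide
  by_cases hdist : ∃ i j, i ≠ j ∧ 8 ∣ d i ∧ 6 ∣ d j
  · obtain ⟨i, j, hij, hi, hj⟩ := hdist
    obtain ⟨k, hik, hjk⟩ := hthird i j hij
    obtain ⟨m, hm⟩ := hi
    obtain ⟨n, hn⟩ : 12 ∣ d j := by have := h4 j; omega
    obtain ⟨e, he⟩ := h4 k
    refine exists_squares_of_three hij hik hjk
      (Or.inl ⟨_, _, ?_, (isWeightedHomogeneous_X_baseWeight 1).pow m, rfl⟩)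
      (Or.inl ⟨_, _, ?_, (isWeightedHomogeneous_X_baseWeight 2).pow n, rfl⟩)
      (Or.inl ⟨_, _, ?_, (isWeightedHomogeneous_X_baseWeight 0).pow e, rfl⟩) fun x h1 h2 h3 => ?_
    · simp [baseWeight]; omega
    · simp [baseWeight]; omega
    · simp [baseWeight]; omega
    · simp at h1 h2 h3
      exact ⟨h3.1, h1.1, h2.1⟩
  · push Not at hdist
    obtain ⟨j, hj⟩ := h6
    obtain ⟨i, hi⟩ := h8
    obtain rfl : i = j := by
      by_contra hij
      exact hdist i j hij hi hj
    have hne (l : Fin 3) (hl : i ≠ l) : ¬ 8 ∣ d l ∧ ¬ 6 ∣ d l :=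
      ⟨fun h => hdist l i hl.symm h hj, hdist i l hl hi⟩
    have hpair : ∀ i : Fin 3, ∃ j k, i ≠ j ∧ i ≠ k ∧ j ≠ k := by decide
    obtain ⟨j, k, hij, hik, hjk, hdj⟩ : ∃ j k, i ≠ j ∧ i ≠ k ∧ j ≠ k ∧ d j ≠ 4 := by
      obtain ⟨j, k, hij, hik, hjk⟩ := hpair i
      by_cases hdj : d j = 4
      · exact ⟨k, j, hik, hij, hjk.symm, fun h => h44 j k hjk ⟨hdj, h⟩⟩
      · exact ⟨j, k, hij, hik, hjk, hdj⟩
    obtain ⟨m, hm⟩ : 24 ∣ d i := by omega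
    obtain ⟨e, he⟩ : ∃ e, d j = 20 + 8 * e := ⟨(d j - 20) / 8, by
      have := h4 j
      have := hne j hij
      omega⟩
    obtain ⟨f, hf⟩ := h4 k
    refine exists_squares_of_three hij hik hjk
      (Or.inl ⟨_, _, ?_, (isWeightedHomogeneous_sextic 0).pow m, rfl⟩)
      (Or.inl ⟨_, _, ?_, (isWeightedHomogeneous_X_baseWeight 2).mul
        ((isWeightedHomogeneous_X_baseWeight 1).pow (e + 1)), rfl⟩)
      (Or.inl ⟨_, _, ?_, (isWeightedHomogeneous_X_baseWeight 0).pow f, rfl⟩) fun x h1 h2 h3 => ?_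
    · simp; omega
    · simp [baseWeight]; omega
    · simp [baseWeight]; omega
    · simp at h1 h2 h3
      have h4 := h1.1
      rcases h2 with h2 | h2
      · simp [h2] at h4
        exact ⟨h3.1, h4, h2⟩
      · simp [h2] at h4
        exact ⟨h3.1, h2, h4⟩

theorem exists_squares_of_not_four_dvd {d : Fin 3 → ℕ} (hd : ∀ k, 0 < d k)
    {i j k : Fin 3} (hij : i ≠ j) (hik : i ≠ k) (hjk : j ≠ k) (h422 : d j = 4 → d k ≠ 22)
    {e' : ℕ} (hk : d k = 18 + 4 * e') (hi : 8 ∣ d i) (hj : 4 ∣ d j) (h6 : ∃ k, 6 ∣ d k) :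
    ∃ R : Fin 3 → MvPolynomial (Fin 3) ℂ,
      (∀ k, IsSquareOfInvariant (d k) (R k)) ∧ ∀ x, (∀ k, eval x (R k) = 0) → x = 0 := by
  have hall : ∀ l, l = i ∨ l = j ∨ l = k := by
    have h : ∀ i j k : Fin 3, i ≠ j → i ≠ k → j ≠ k → ∀ l, l = i ∨ l = j ∨ l = k := by decide
    exact h i j k hij hik hjk
  have h12 {i j : Fin 3} (hij : i ≠ j) (hik : i ≠ k) (hjk : j ≠ k) (hi : 8 ∣ d i)
      (hj : 12 ∣ d j) : ∃ R : Fin 3 → MvPolynomial (Fin 3) ℂ,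
      (∀ k, IsSquareOfInvariant (d k) (R k)) ∧ ∀ x, (∀ k, eval x (R k) = 0) → x = 0 := by
    obtain ⟨m, hm⟩ := hi
    obtain ⟨n, hn⟩ := hj
    refine exists_squares_of_three hij hik hjk
      (Or.inl ⟨_, _, ?_, isWeightedHomogeneous_quadratic.pow m, rfl⟩)
      (Or.inl ⟨_, _, ?_, (isWeightedHomogeneous_X_baseWeight 2).pow n, rfl⟩)
      (Or.inr ⟨_, _, ?_, (isWeightedHomogeneous_X_baseWeight 0).pow e', rfl⟩) fun x h1 h2 h3 => ?_
    · simp; omega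
    · simp [baseWeight]; omega
    · simp [baseWeight]; omega
    · simp [eval_skewSq] at h1 h2 h3
      have h4 := h1.1
      have h5 := h2.1
      have h6 : x 0 = 0 := by
        rcases h3 with h3 | h3
        · rw [h5, eq_neg_of_add_eq_zero_left h4] at h3
          have h7 : x 0 ^ 9 = 0 := by linear_combination h3
          exact pow_eq_zero_iff (by norm_num) |>.mp h7
        · exact h3.1
      exact ⟨h6, by simpa [h6] using h4, h5⟩
  by_cases hk6 : 6 ∣ d k
  · obtain ⟨m, hm⟩ := hi
    obtain ⟨n, hn⟩ : 3 ∣ e' := by omega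
    obtain ⟨e, he⟩ := hj
    refine exists_squares_of_three hij hik hjk
      (Or.inl ⟨_, _, ?_, (isWeightedHomogeneous_X_baseWeight 1).pow m, rfl⟩)
      (Or.inl ⟨_, _, ?_, (isWeightedHomogeneous_X_baseWeight 0).pow e, rfl⟩)
      (Or.inr ⟨_, _, ?_, (isWeightedHomogeneous_X_baseWeight 2).pow n, rfl⟩) fun x h1 h2 h3 => ?_
    · simp [baseWeight]; omega
    · simp [baseWeight]; omega
    · simp [baseWeight]; omega
    · simp [eval_skewSq] at h1 h2 h3
      simp [h1.1, h2.1] at h3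
      refine ⟨h2.1, h1.1, ?_⟩
      tauto
  by_cases hj6 : 6 ∣ d j
  · exact h12 hij hik hjk hi (by omega)
  by_cases hj8 : 8 ∣ d j
  · refine h12 hij.symm hjk hik hj8 ?_
    obtain ⟨l, hl⟩ := h6
    rcases hall l with rfl | rfl | rfl
    · omega
    · exact absurd hl hj6
    · exact absurd hl hk6
  obtain ⟨m, hm⟩ : 24 ∣ d i := by
    obtain ⟨l, hl⟩ := h6
    rcases hall l with rfl | rfl | rfl
    · omega
    · exact absurd hl hj6
    · exact absurd hl hk6
  by_cases hj4 : d j = 4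
  · have he : ∃ s t, e' = 2 * s + 3 * t := by
      have := h422 hj4
      rcases Nat.even_or_odd' e' with ⟨s, rfl | rfl⟩
      · exact ⟨s, 0, by omega⟩
      · exact ⟨s - 1, 1, by omega⟩
    obtain ⟨s, t, rfl⟩ := he
    refine exists_squares_of_three hij hik hjk
      (Or.inl ⟨_, _, ?_, (isWeightedHomogeneous_sextic 0).pow m, rfl⟩)
      (Or.inl ⟨_, _, ?_, isWeightedHomogeneous_X_baseWeight 0, rfl⟩)
      (Or.inr ⟨_, _, ?_, ((isWeightedHomogeneous_X_baseWeight 1).pow s).mul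
        ((isWeightedHomogeneous_X_baseWeight 2).pow t), rfl⟩) fun x h1 h2 h3 => ?_
    · simp; omega
    · simp [baseWeight]; omega
    · simp [baseWeight]; omega
    · simp [eval_skewSq] at h1 h2 h3
      have h4 := h1.1
      refine ⟨h2, ?_⟩
      rcases h3 with h3 | h3 | h3
      · have h7 : x 2 ^ 3 = 0 := by
          rw [h2] at h3
          linear_combination (1 / 55) * x 2 * h4 - (1 / 440) * h3
        have h8 : x 2 = 0 := pow_eq_zero_iff (by norm_num) |>.mp h7
        simp [h8] at h4
        exact ⟨h4, h8⟩
      · simp [h3.1] at h4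
        exact ⟨h3.1, h4⟩
      · simp [h3.1] at h4
        exact ⟨h4, h3.1⟩
  · obtain ⟨e, he⟩ : ∃ e, d j = 20 + 8 * e := ⟨(d j - 20) / 8, by
      have := hd j
      omega⟩
    refine exists_squares_of_three hij hik hjk
      (Or.inl ⟨_, _, ?_, (isWeightedHomogeneous_sextic 1).pow m, rfl⟩)
      (Or.inl ⟨_, _, ?_, (isWeightedHomogeneous_X_baseWeight 2).mul
        ((isWeightedHomogeneous_X_baseWeight 1).pow (e + 1)), rfl⟩)
      (Or.inr ⟨_, _, ?_, (isWeightedHomogeneous_X_baseWeight 0).pow e', rfl⟩) fun x h1 h2 h3 => ?_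
    · simp; omega
    · simp [baseWeight]; omega
    · simp [baseWeight]; omega
    · simp [eval_skewSq] at h1 h2 h3
      have h4 := h1.1
      have h0 : x 0 = 0 := by
        rcases h3 with h3 | h3
        · rcases h2 with h2 | h2
          · rw [h2] at h3 h4
            by_contra hx
            have hx1 : x 1 = 0 := by
              simpa [hx] using h3
            simp [hx1, hx] at h4
          · rw [h2] at h3 h4
            by_contra hx
            have hx2 : x 2 ≠ 0 := by
              intro hx2
              simp [hx2, hx] at h4
            have h5 : 432 * x 2 = x 0 ^ 3 := by
              refine mul_left_cancel₀ (pow_ne_zero 2 hx2) ?_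
              linear_combination -h3
            have h6 : x 0 ^ 6 = 0 := by
              linear_combination (432 ^ 2 / (432 ^ 2 + 1)) * h4 -
                (432 * x 2 + x 0 ^ 3) / (432 ^ 2 + 1) * h5
            exact hx (pow_eq_zero_iff (by norm_num) |>.mp h6)
        · exact h3.1
      refine ⟨h0, ?_⟩
      simp [h0] at h4
      rcases h2 with h2 | h2
      · simp [h2] at h4
        exact ⟨h4, h2⟩
      · simp [h2] at h4
        exact ⟨h2, h4⟩

theorem stmt_12 (d : Fin 3 → ℕ) (hd : ∀ k, 0 < d k) :
    (∃ p : Fin (5-2) → invariantRing 5, IsHSOP 5 d p) ↔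
      ((∀ k, 2 ∣ d k) ∧
       (∀ k, d k ∉ ({2, 6, 10, 14} : Set ℕ)) ∧
       ¬ (({4, 4} : Multiset ℕ) ≤ Finset.univ.val.map d) ∧
       ¬ (({4, 22} : Multiset ℕ) ≤ Finset.univ.val.map d) ∧
       2 ≤ (Finset.univ.filter fun k => 4 ∣ d k).card ∧
       (∃ k, 6 ∣ d k) ∧ (∃ k, 8 ∣ d k)) := by
  simp only [pair_le_map_univ_iff, two_le_card_filter_iff]
  constructor
  · rintro ⟨p, hp⟩
    obtain ⟨R, hR, h0⟩ := hp.exists_squares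
    obtain ⟨h1, h2, h3, h4⟩ := necessary_conditions hd hR h0
    refine ⟨h1, h2, ?_, ?_, h4⟩
    · rintro ⟨i, j, hij, hi, hj⟩
      exact h3 i j hij ⟨hi, Or.inl hj⟩
    · rintro ⟨i, j, hij, hi, hj⟩
      exact h3 i j hij ⟨hi, Or.inr hj⟩
  · rintro ⟨h2, hlow, h44, h422, h4, h6, h8⟩
    suffices h : ∃ R : Fin 3 → MvPolynomial (Fin 3) ℂ, (∀ k, IsSquareOfInvariant (d k) (R k)) ∧
        ∀ x, (∀ k, eval x (R k) = 0) → x = 0 by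
      obtain ⟨R, hR, h0⟩ := h
      exact exists_isHSOP hd hR h0
    by_cases hall : ∀ k, 4 ∣ d k
    · exact exists_squares_of_four_dvd (fun i j hij h => h44 ⟨i, j, hij, h⟩) hall h6 h8
    push Not at hall
    obtain ⟨k, hk⟩ := hall
    obtain ⟨e, he⟩ : ∃ e, d k = 18 + 4 * e := ⟨(d k - 18) / 4, by
      have h := hlow k
      have := h2 k
      simp only [Set.mem_insert_iff, Set.mem_singleton_iff] at h
      omega⟩
    obtain ⟨i, hi⟩ := h8
    have hik : i ≠ k := by
      rintro rfl
      omega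
    obtain ⟨j, hij, hjk⟩ : ∃ j, i ≠ j ∧ j ≠ k := by
      have h : ∀ i k : Fin 3, ∃ j, i ≠ j ∧ j ≠ k := by decide
      exact h i k
    exact exists_squares_of_not_four_dvd hd hij hik hjk (fun h h' => h422 ⟨j, k, hjk, h, h'⟩) he hi
      ((h4 j k hjk).resolve_right hk) h6
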